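/- arXiv:2202.08162 — 3 statements merged into one kernel-verified Lean document; each statement's English description precedes it below -/
import Mathlib

section
/- If η(x) = Π_{s=1}^k (x − b_s)^{n_s} with b_1, ..., b_k pairwise distinct, then the Weyl module W_η is isomorphic as a gl(1|1)[t]-module to the tensor product W_{n_1}(b_1) ⊗ ... ⊗ W_{n_k}(b_k); in particular dim W_η = 2^{n_1 + ... + n_k}. -/
set_option synthInstance.maxHeartbeats 1000000
set_option maxHeartbeats 1000000

/-- A representation of the current superalgebra `gl(1|1)[t]` on a complex vector space:
operators `E i j r` (representing `e_{i+1,j+1}[r] = e_{i+1,j+1} ⊗ tʳ`) satisfying the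
supercommutator relations
`[e_{ij}[r], e_{kl}[s]] = δ_{jk} e_{il}[r+s] − (−1)^{(|i|+|j|)(|k|+|l|)} δ_{il} e_{kj}[r+s]`
(anticommutator when both elements are odd). -/
structure CurrentRep (W : Type) [AddCommGroup W] [Module ℂ W] where
  E : Fin 2 → Fin 2 → ℕ → Module.End ℂ W
  rel : ∀ (i j k l : Fin 2) (r s : ℕ),
    E i j r * E k l s -
        ((-1 : ℂ) ^ (((i : ℕ) + (j : ℕ)) * ((k : ℕ) + (l : ℕ)))) • (E k l s * E i j r) =
      (if j = k then E i l (r + s) else 0) -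
        ((-1 : ℂ) ^ (((i : ℕ) + (j : ℕ)) * ((k : ℕ) + (l : ℕ)))) •
          (if i = l then E k j (r + s) else 0)

/-- `w` generates `W` as a `gl(1|1)[t]`-module. -/
def CurrentRep.IsCyclic {W : Type} [AddCommGroup W] [Module ℂ W]
    (ρ : CurrentRep W) (w : W) : Prop :=
  ∀ P : Submodule ℂ W, (∀ (i j : Fin 2) (r : ℕ) (x : W), x ∈ P → ρ.E i j r x ∈ P) →
    w ∈ P → P = ⊤

open scoped TensorProduct

/-- A `ℤ₂`-graded `gl(1|1)[t]`-representation: a current representation together with a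
parity operator `J` commuting with even and anticommuting with odd generators. -/
structure GradedCurrentRep (W : Type) [AddCommGroup W] [Module ℂ W] extends CurrentRep W where
  J : Module.End ℂ W
  J_sq : J * J = 1
  J_E : ∀ (i j : Fin 2) (r : ℕ),
    J * E i j r = ((-1 : ℂ) ^ ((i : ℕ) + (j : ℕ))) • (E i j r * J)

/-- The defining relations of the Weyl module `W_η` for `η(x) = Π_s (x − b_s)^{n_s}`:
`e₁₁(x)w = (η'/η)w` (i.e. `e₁₁[r]w = (Σ_s n_s b_sʳ) w`), `e₂₂(x)w = e₁₂(x)w = 0`,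
`(e₂₁ ⊗ η(t))w = 0`, and `w` generates. -/
def IsWeylVec (k : ℕ) (b : Fin k → ℂ) (nn : Fin k → ℕ) {W : Type}
    [AddCommGroup W] [Module ℂ W] (ρ : CurrentRep W) (w : W) : Prop :=
  (∀ r : ℕ, ρ.E 0 0 r w = (∑ s, (nn s : ℂ) * b s ^ r) • w) ∧
  (∀ r : ℕ, ρ.E 1 1 r w = 0) ∧ (∀ r : ℕ, ρ.E 0 1 r w = 0) ∧
  (∑ i ∈ Finset.range ((∑ s, nn s) + 1),
      ((∏ s, (Polynomial.X - Polynomial.C (b s)) ^ nn s : Polynomial ℂ).coeff i) •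
        ρ.E 1 0 i w = 0) ∧
  ρ.IsCyclic w

/-- `(W, ρ, w)` is the Weyl module `W_η`, `η = Π_s (x−b_s)^{n_s}`: it satisfies the defining
relations and is universal among modules generated by a vector satisfying them. -/
def IsWeylModule (k : ℕ) (b : Fin k → ℂ) (nn : Fin k → ℕ) (W : Type)
    [AddCommGroup W] [Module ℂ W] (ρ : CurrentRep W) (w : W) : Prop :=
  IsWeylVec k b nn ρ w ∧
  ∀ (W' : Type) [AddCommGroup W'] [Module ℂ W'] (ρ' : CurrentRep W') (w' : W'),
    IsWeylVec k b nn ρ' w' →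
      ∃ f : W →ₗ[ℂ] W', f w = w' ∧ ∀ (i j : Fin 2) (r : ℕ) (x : W),
        f (ρ.E i j r x) = ρ'.E i j r (f x)

/-- The action of `e_{i+1,j+1}[r]` on the graded tensor product `W₁ ⊗ ... ⊗ W_k`:
`Σ_s J^{|e_{ij}|} ⊗ ... ⊗ J^{|e_{ij}|} ⊗ e_{ij}[r] ⊗ 1 ⊗ ... ⊗ 1` (super sign rule). -/
noncomputable def tensorE {k : ℕ} {Wf : Fin k → Type}
    [∀ s, AddCommGroup (Wf s)] [∀ s, Module ℂ (Wf s)]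
    (ρf : ∀ s, GradedCurrentRep (Wf s)) (i j : Fin 2) (r : ℕ) :
    Module.End ℂ (⨂[ℂ] s, Wf s) :=
  ∑ s : Fin k, PiTensorProduct.map fun u =>
    if u < s then (ρf u).J ^ ((i : ℕ) + (j : ℕ))
    else if u = s then (ρf u).E i j r else 1

section WeylHelpers

open Polynomial

/-- `f ↦ ∑ coeff f i • a i`. -/
noncomputable def polyAct {A : Type*} [AddCommGroup A] [Module ℂ A] (a : ℕ → A) :
    ℂ[X] →ₗ[ℂ] A :=
  Polynomial.lsum (fun i => LinearMap.toSpanSingleton ℂ A (a i))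

lemma polyAct_apply {A : Type*} [AddCommGroup A] [Module ℂ A] (a : ℕ → A) (f : ℂ[X]) :
    polyAct a f = f.sum (fun i c => c • a i) := by
  simp [polyAct, Polynomial.lsum_apply]

lemma polyAct_X_pow {A : Type*} [AddCommGroup A] [Module ℂ A] (a : ℕ → A) (n : ℕ) :
    polyAct a (X ^ n) = a n := by
  rw [polyAct_apply, ← Polynomial.monomial_one_right_eq_X_pow, Polynomial.sum_monomial_index] <;>
    simp

lemma polyAct_range {A : Type*} [AddCommGroup A] [Module ℂ A] (a : ℕ → A) (f : ℂ[X]) (N : ℕ)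
    (h : f.natDegree < N) :
    polyAct a f = ∑ i ∈ Finset.range N, f.coeff i • a i := by
  rw [polyAct_apply, Polynomial.sum_over_range' _ _ _ h]
  simp

/-- Induction principle for equalities of linear maps. -/
lemma poly_lin_ext {A : Type*} [AddCommGroup A] [Module ℂ A] (f g : ℂ[X] →ₗ[ℂ] A)
    (h : ∀ n, f (X ^ n) = g (X ^ n)) : f = g := by
  ext n
  simpa [Polynomial.monomial_one_right_eq_X_pow] using h n

section rels
variable {W : Type} [AddCommGroup W] [Module ℂ W] (ρ : CurrentRep W)

lemma rel10_10 (r s : ℕ) : ρ.E 1 0 r * ρ.E 1 0 s = - (ρ.E 1 0 s * ρ.E 1 0 r) := by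
  have := ρ.rel 1 0 1 0 r s
  simpa [add_eq_zero_iff_eq_neg] using this

lemma rel11_10 (r s : ℕ) :
    ρ.E 1 1 r * ρ.E 1 0 s = ρ.E 1 0 s * ρ.E 1 1 r + ρ.E 1 0 (r + s) := by
  have := ρ.rel 1 1 1 0 r s
  simpa [sub_eq_iff_eq_add, add_comm] using this

lemma rel00_10 (r s : ℕ) :
    ρ.E 0 0 r * ρ.E 1 0 s = ρ.E 1 0 s * ρ.E 0 0 r - ρ.E 1 0 (r + s) := by
  have := ρ.rel 0 0 1 0 r s
  simp [sub_eq_iff_eq_add] at this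
  rw [this]; abel

lemma rel01_10 (r s : ℕ) :
    ρ.E 0 1 r * ρ.E 1 0 s =
      - (ρ.E 1 0 s * ρ.E 0 1 r) + ρ.E 0 0 (r + s) + ρ.E 1 1 (r + s) := by
  have := ρ.rel 0 1 1 0 r s
  simp at this
  rw [add_assoc, ← this]; abel

end rels

/-- Monomials in the `E 1 0 r` applied to `w`. -/
inductive WMono {W : Type} [AddCommGroup W] [Module ℂ W] (ρ : CurrentRep W) (w : W) :
    ℕ → W → Prop
  | base : WMono ρ w 0 w
  | step (m : ℕ) (x : W) (r : ℕ) : WMono ρ w m x → WMono ρ w (m + 1) (ρ.E 1 0 r x)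

section weyl
variable {k : ℕ} {b : Fin k → ℂ} {nn : Fin k → ℕ} {W : Type} [AddCommGroup W] [Module ℂ W]
  {ρ : CurrentRep W} {w : W}

lemma span_mono (hw : IsWeylVec k b nn ρ w) :
    Submodule.span ℂ {x | ∃ m, WMono ρ w m x} = ⊤ := by
  obtain ⟨h00, h11, h01, -, hc⟩ := hw
  set M := Submodule.span ℂ {x | ∃ m, WMono ρ w m x} with hM
  have h10 : ∀ r x, x ∈ M → ρ.E 1 0 r x ∈ M := by
    intro r x hx
    induction hx using Submodule.span_induction with
    | mem x hx =>
      obtain ⟨m, hm⟩ := hx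
      exact Submodule.subset_span ⟨m + 1, WMono.step m x r hm⟩
    | zero => simp
    | add x y _ _ hx hy => rw [map_add]; exact M.add_mem hx hy
    | smul c x _ hx => rw [map_smul]; exact M.smul_mem c hx
  have hwM : w ∈ M := Submodule.subset_span ⟨0, WMono.base⟩
  have hall : ∀ m x, WMono ρ w m x → x ∈ M ∧
      (∀ r, ρ.E 0 0 r x ∈ M) ∧ (∀ r, ρ.E 1 1 r x ∈ M) ∧ (∀ r, ρ.E 0 1 r x ∈ M) := by
    intro m x hx
    induction hx with
    | base =>
      refine ⟨hwM, fun r => ?_, fun r => ?_, fun r => ?_⟩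
      · rw [h00]; exact M.smul_mem _ hwM
      · rw [h11]; exact M.zero_mem
      · rw [h01]; exact M.zero_mem
    | step m x s _ ih =>
      obtain ⟨ix, i0, i1, i01⟩ := ih
      refine ⟨h10 _ _ ix, fun r => ?_, fun r => ?_, fun r => ?_⟩
      · have := congrArg (fun f => f x) (rel00_10 ρ r s)
        simp only [Module.End.mul_apply, LinearMap.sub_apply] at this
        rw [this]
        exact M.sub_mem (h10 _ _ (i0 r)) (h10 _ _ ix)
      · have := congrArg (fun f => f x) (rel11_10 ρ r s)
        simp only [Module.End.mul_apply, LinearMap.add_apply] at this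
        rw [this]
        exact M.add_mem (h10 _ _ (i1 r)) (h10 _ _ ix)
      · have := congrArg (fun f => f x) (rel01_10 ρ r s)
        simp only [Module.End.mul_apply, LinearMap.add_apply, LinearMap.neg_apply] at this
        rw [this]
        exact M.add_mem (M.add_mem (M.neg_mem (h10 _ _ (i01 r))) (i0 _)) (i1 _)
  have ext : ∀ f : Module.End ℂ W, (∀ m x, WMono ρ w m x → f x ∈ M) → ∀ x ∈ M, f x ∈ M := by
    intro f hf x hx
    induction hx using Submodule.span_induction with
    | mem x hx => obtain ⟨m, hm⟩ := hx; exact hf m x hm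
    | zero => simp
    | add x y _ _ hx hy => rw [map_add]; exact M.add_mem hx hy
    | smul c x _ hx => rw [map_smul]; exact M.smul_mem c hx
  apply hc M _ hwM
  intro i j r x hx
  fin_cases i <;> fin_cases j
  · exact ext _ (fun m y hy => (hall m y hy).2.1 r) x hx
  · exact ext _ (fun m y hy => (hall m y hy).2.2.2 r) x hx
  · exact h10 r x hx
  · exact ext _ (fun m y hy => (hall m y hy).2.2.1 r) x hx

lemma closed10_top (hw : IsWeylVec k b nn ρ w) (P : Submodule ℂ W) (hwP : w ∈ P)
    (h : ∀ r x, x ∈ P → ρ.E 1 0 r x ∈ P) : P = ⊤ := by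
  rw [eq_top_iff, ← span_mono hw, Submodule.span_le]
  rintro x ⟨m, hm⟩
  induction hm with
  | base => exact hwP
  | step m x r _ ih => exact h r x ih

lemma WMono.weight (hw : IsWeylVec k b nn ρ w) {m : ℕ} {x : W} (hx : WMono ρ w m x) :
    ρ.E 1 1 0 x = (m : ℂ) • x := by
  induction hx with
  | base => simp [hw.2.1]
  | step m x r _ ih =>
    have := congrArg (fun f => f x) (rel11_10 ρ 0 r)
    simp only [Module.End.mul_apply, LinearMap.add_apply] at this
    rw [this, ih, map_smul]
    simp [add_smul]

/-- The zero eigenspace of `E 1 1 0` is spanned by `w`. -/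
lemma weight_zero (hw : IsWeylVec k b nn ρ w) {x : W} (hx : ρ.E 1 1 0 x = 0) :
    ∃ c : ℂ, x = c • w := by
  set T := ρ.E 1 1 0 with hT
  set U : Submodule ℂ W := ⨆ j : ℂ, ⨆ _ : j ≠ 0, T.eigenspace j with hU
  have hx0 : x ∈ T.eigenspace 0 := by
    rw [Module.End.mem_eigenspace_iff, hx]; simp
  have hw0 : w ∈ T.eigenspace 0 := by
    rw [Module.End.mem_eigenspace_iff, hT, hw.2.1]; simp
  have hdisj : Disjoint (T.eigenspace 0) U := T.eigenspaces_iSupIndep 0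
  have htop : Submodule.span ℂ {w} ⊔ U = ⊤ := by
    rw [eq_top_iff, ← span_mono hw, Submodule.span_le]
    rintro y ⟨m, hm⟩
    have hwt := hm.weight hw
    cases hm with
    | base => exact Submodule.mem_sup_left (Submodule.mem_span_singleton_self w)
    | step m y r h =>
      apply Submodule.mem_sup_right
      refine Submodule.mem_iSup_of_mem ((m + 1 : ℕ) : ℂ) (Submodule.mem_iSup_of_mem ?_ ?_)
      · exact_mod_cast Nat.succ_ne_zero m
      · rw [Module.End.mem_eigenspace_iff]; exact hwt
  have hxt : x ∈ Submodule.span ℂ {w} ⊔ U := by rw [htop]; trivial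
  obtain ⟨y, hy, z, hz, rfl⟩ := Submodule.mem_sup.1 hxt
  obtain ⟨c, rfl⟩ := Submodule.mem_span_singleton.1 hy
  have hz0 : z ∈ T.eigenspace 0 := by
    have := Submodule.sub_mem _ hx0 (Submodule.smul_mem _ c hw0)
    simpa using this
  have : z = 0 := Submodule.disjoint_def.1 hdisj z hz0 hz
  exact ⟨c, by simp [this]⟩

/-- the defining polynomial -/
noncomputable def etaP (k : ℕ) (b : Fin k → ℂ) (nn : Fin k → ℕ) : ℂ[X] :=
  ∏ s, (X - C (b s)) ^ nn s

lemma etaP_monic (k : ℕ) (b : Fin k → ℂ) (nn : Fin k → ℕ) : (etaP k b nn).Monic :=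
  monic_prod_of_monic _ _ fun s _ => (monic_X_sub_C (b s)).pow _

lemma etaP_natDegree (k : ℕ) (b : Fin k → ℂ) (nn : Fin k → ℕ) :
    (etaP k b nn).natDegree = ∑ s, nn s := by
  rw [etaP, natDegree_prod_of_monic _ _ (fun s _ => (monic_X_sub_C (b s)).pow _)]
  simp [natDegree_pow]

lemma eta_sum {A : Type*} [AddCommGroup A] [Module ℂ A] (a : ℕ → A)
    (k : ℕ) (b : Fin k → ℂ) (nn : Fin k → ℕ) :
    ∑ i ∈ Finset.range ((∑ s, nn s) + 1),
      ((∏ s, (Polynomial.X - Polynomial.C (b s)) ^ nn s : Polynomial ℂ).coeff i) • a i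
      = polyAct a (etaP k b nn) := by
  rw [polyAct_range a _ ((∑ s, nn s) + 1)]
  · rfl
  · rw [etaP_natDegree]; omega

lemma eta_w (hw : IsWeylVec k b nn ρ w) : polyAct (ρ.E 1 0) (etaP k b nn) w = 0 := by
  have := hw.2.2.2.1
  rw [← eta_sum]
  simpa [LinearMap.sum_apply] using this

lemma polyAct_X_mul (f : ℂ[X]) :
    ρ.E 1 1 1 * polyAct (ρ.E 1 0) f =
      polyAct (ρ.E 1 0) f * ρ.E 1 1 1 + polyAct (ρ.E 1 0) (X * f) := by
  have : (LinearMap.mulLeft ℂ (ρ.E 1 1 1)) ∘ₗ polyAct (ρ.E 1 0) =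
      (LinearMap.mulRight ℂ (ρ.E 1 1 1)) ∘ₗ polyAct (ρ.E 1 0) +
      polyAct (ρ.E 1 0) ∘ₗ LinearMap.mulLeft ℂ (X : ℂ[X]) := by
    apply poly_lin_ext
    intro n
    simp only [LinearMap.comp_apply, LinearMap.add_apply, LinearMap.mulLeft_apply,
      LinearMap.mulRight_apply, ← pow_succ', polyAct_X_pow]
    rw [rel11_10, add_comm 1 n]
  exact congrArg (fun g => g f) this

lemma polyAct_anti (f g : ℂ[X]) :
    polyAct (ρ.E 1 0) f * polyAct (ρ.E 1 0) g = -(polyAct (ρ.E 1 0) g * polyAct (ρ.E 1 0) f) := by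
  have h1 : ∀ r, polyAct (ρ.E 1 0) f * ρ.E 1 0 r = -(ρ.E 1 0 r * polyAct (ρ.E 1 0) f) := by
    intro r
    have : (LinearMap.mulRight ℂ (ρ.E 1 0 r)) ∘ₗ polyAct (ρ.E 1 0) =
      -((LinearMap.mulLeft ℂ (ρ.E 1 0 r)) ∘ₗ polyAct (ρ.E 1 0)) := by
      apply poly_lin_ext
      intro n
      simp only [LinearMap.comp_apply, LinearMap.neg_apply, LinearMap.mulLeft_apply,
        LinearMap.mulRight_apply, polyAct_X_pow]
      rw [rel10_10]
    exact congrArg (fun g => g f) this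
  have : (LinearMap.mulLeft ℂ (polyAct (ρ.E 1 0) f)) ∘ₗ polyAct (ρ.E 1 0) =
      -((LinearMap.mulRight ℂ (polyAct (ρ.E 1 0) f)) ∘ₗ polyAct (ρ.E 1 0)) := by
    apply poly_lin_ext
    intro n
    simp only [LinearMap.comp_apply, LinearMap.neg_apply, LinearMap.mulLeft_apply,
        LinearMap.mulRight_apply, polyAct_X_pow]
    exact h1 n
  exact congrArg (fun h => h g) this

lemma eta_kill (hw : IsWeylVec k b nn ρ w) {f : ℂ[X]} (hf : etaP k b nn ∣ f) :
    polyAct (ρ.E 1 0) f = 0 := by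
  obtain ⟨g, rfl⟩ := hf
  have hpow : ∀ n, polyAct (ρ.E 1 0) (etaP k b nn * X ^ n) w = 0 := by
    intro n
    induction n with
    | zero => simpa using eta_w hw
    | succ n ih =>
      have := congrArg (fun f => f w) (polyAct_X_mul (ρ := ρ) (etaP k b nn * X ^ n))
      simp only [Module.End.mul_apply, LinearMap.add_apply, ih, hw.2.1, map_zero, zero_add] at this
      rw [this]
      congr 2
      ring
  have hw0 : polyAct (ρ.E 1 0) (etaP k b nn * g) w = 0 := by
    have : (LinearMap.applyₗ w) ∘ₗ polyAct (ρ.E 1 0) ∘ₗ LinearMap.mulLeft ℂ (etaP k b nn) = 0 := by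
      apply poly_lin_ext
      intro n
      simpa using hpow n
    exact congrArg (fun h => h g) this
  have : LinearMap.ker (polyAct (ρ.E 1 0) (etaP k b nn * g)) = ⊤ := by
    apply closed10_top hw
    · exact hw0
    · intro r x hx
      rw [LinearMap.mem_ker] at hx ⊢
      have := congrArg (fun f => f x) (polyAct_anti (ρ := ρ) (etaP k b nn * g) (X ^ r))
      simp only [Module.End.mul_apply, LinearMap.neg_apply, polyAct_X_pow, hx, map_zero,
        neg_zero] at this
      exact this
  exact LinearMap.ker_eq_top.1 this

/-- The linear map from the exterior algebra onto the Weyl module. -/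
lemma exists_ext_surj (hw : IsWeylVec k b nn ρ w) :
    ∃ f : ExteriorAlgebra ℂ (AdjoinRoot (etaP k b nn)) →ₗ[ℂ] W, Function.Surjective f := by
  have hmon := etaP_monic k b nn
  let L : AdjoinRoot (etaP k b nn) →ₗ[ℂ] Module.End ℂ W :=
    polyAct (ρ.E 1 0) ∘ₗ AdjoinRoot.modByMonicHom hmon
  have hL2 : ∀ m, L m * L m = 0 := by
    intro m
    have h := polyAct_anti (ρ := ρ) (AdjoinRoot.modByMonicHom hmon m)
      (AdjoinRoot.modByMonicHom hmon m)
    have h2 : (2 : ℂ) • (L m * L m) = 0 := by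
      rw [two_smul]; exact eq_neg_iff_add_eq_zero.1 h
    exact (smul_eq_zero.1 h2).resolve_left two_ne_zero
  have hLX : ∀ r, L (AdjoinRoot.mk _ (X ^ r)) = ρ.E 1 0 r := by
    intro r
    simp only [L, LinearMap.comp_apply, AdjoinRoot.modByMonicHom_mk]
    rw [← polyAct_X_pow (ρ.E 1 0) r]
    have := modByMonic_add_div (X ^ r : ℂ[X]) (etaP k b nn)
    conv_rhs => rw [← this]
    rw [map_add, eta_kill hw (dvd_mul_right _ _), add_zero]
  let Φ := ExteriorAlgebra.lift ℂ ⟨L, hL2⟩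
  refine ⟨(LinearMap.applyₗ w) ∘ₗ Φ.toLinearMap, ?_⟩
  rw [← LinearMap.range_eq_top]
  apply closed10_top hw
  · exact ⟨1, by simp⟩
  · rintro r _ ⟨y, rfl⟩
    refine ⟨ExteriorAlgebra.ι ℂ (AdjoinRoot.mk _ (X ^ r)) * y, ?_⟩
    simp only [LinearMap.comp_apply, AlgHom.toLinearMap_apply, map_mul, LinearMap.applyₗ_apply_apply,
      Module.End.mul_apply, Φ, ExteriorAlgebra.lift_ι_apply, hLX]

end weyl

section model

variable {F : Type} [CommRing F] [Algebra ℂ F] {κ : Type} [Fintype κ]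
  (v : Module.Basis κ ℂ F) (τ : F →ₗ[ℂ] ℂ)

/-- creation operators -/
noncomputable def mI (a : F) : Module.End ℂ (ExteriorAlgebra ℂ F) :=
  LinearMap.mulLeft ℂ (ExteriorAlgebra.ι ℂ a)

/-- contraction -/
noncomputable def mK (d : Module.Dual ℂ F) : Module.End ℂ (ExteriorAlgebra ℂ F) :=
  CliffordAlgebra.contractLeft (Q := (0 : QuadraticForm ℂ F)) d

/-- annihilation operators -/
noncomputable def mC (a : F) : Module.End ℂ (ExteriorAlgebra ℂ F) :=
  mK (τ ∘ₗ LinearMap.mulLeft ℂ a)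

/-- the derivation induced by multiplication -/
noncomputable def mD (a : F) : Module.End ℂ (ExteriorAlgebra ℂ F) :=
  ∑ i, mI (a * v i) * mK (v.coord i)

lemma mI_add (a b : F) : mI (a + b) = mI a + mI b := by
  ext x; simp [mI, add_mul]

lemma mI_smul (c : ℂ) (a : F) : mI (c • a) = c • mI a := by
  ext x; simp [mI]

/-- `mI` as a linear map -/
noncomputable def mIl : F →ₗ[ℂ] Module.End ℂ (ExteriorAlgebra ℂ F) where
  toFun := mI
  map_add' := mI_add
  map_smul' := mI_smul

lemma neg1_smul (T : Module.End ℂ (ExteriorAlgebra ℂ F)) : (-1 : ℂ) • T = -T := by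
  exact neg_one_smul ℂ T

lemma mI_mI (a b : F) : mI a * mI b = -(mI b * mI a) := by
  refine LinearMap.ext fun x => ?_
  have h := ExteriorAlgebra.ι_add_mul_swap (R := ℂ) a b
  simp only [mI, Module.End.mul_apply, LinearMap.mulLeft_apply, LinearMap.neg_apply,
    ← mul_assoc]
  rw [eq_neg_of_add_eq_zero_left h, neg_mul]

lemma mK_mI (d : Module.Dual ℂ F) (a : F) : mK d * mI a = d a • 1 - mI a * mK d := by
  refine LinearMap.ext fun x => ?_
  exact CliffordAlgebra.contractLeft_ι_mul (Q := (0 : QuadraticForm ℂ F)) d a x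

lemma mK_mK (d d' : Module.Dual ℂ F) : mK d * mK d' = -(mK d' * mK d) := by
  refine LinearMap.ext fun x => ?_
  exact CliffordAlgebra.contractLeft_comm (Q := (0 : QuadraticForm ℂ F)) d d' x

lemma mK_one (d : Module.Dual ℂ F) : mK d 1 = 0 :=
  CliffordAlgebra.contractLeft_one (Q := (0 : QuadraticForm ℂ F)) d

lemma ext_ind {P : ExteriorAlgebra ℂ F → Prop} (h1 : P 1)
    (hs : ∀ (c : ℂ) x, P x → P (c • x))
    (hadd : ∀ x y, P x → P y → P (x + y))
    (hI : ∀ a x, P x → P (mI a x)) (x : ExteriorAlgebra ℂ F) : P x := by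
  refine CliffordAlgebra.left_induction (Q := (0 : QuadraticForm ℂ F)) (P := P) ?_ hadd ?_ x
  · intro r
    rw [Algebra.algebraMap_eq_smul_one]
    exact hs r _ h1
  · intro x m hx
    exact hI m x hx

lemma op_zero (T : Module.End ℂ (ExteriorAlgebra ℂ F)) (h1 : T 1 = 0) (c : ℂ)
    (h : ∀ a, T * mI a = c • (mI a * T)) : T = 0 := by
  refine LinearMap.ext fun x => ?_
  induction x using ext_ind with
  | h1 => simpa using h1
  | hs c x hx => simp [hx]
  | hadd x y hx hy => simp [hx, hy]
  | hI a x hx =>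
    have := congrArg (fun f => f x) (h a)
    simp only [Module.End.mul_apply, LinearMap.smul_apply] at this
    rw [this, hx]; simp

lemma mC_mI (a b : F) : mC τ a * mI b = τ (a * b) • 1 - mI b * mC τ a := by
  rw [mC, mK_mI]; simp

lemma mC_mC (a b : F) : mC τ a * mC τ b = -(mC τ b * mC τ a) := mK_mK _ _

lemma mD_one (a : F) : mD v a 1 = 0 := by
  simp [mD, LinearMap.sum_apply, mK_one]

lemma mD_mI (a b : F) : mD v a * mI b = mI b * mD v a + mI (a * b) := by
  have hb : mI (a * b) = ∑ i, v.coord i b • mI (a * v i) := by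
    conv_lhs => rw [← v.sum_repr b]
    rw [Finset.mul_sum]
    change mIl _ = _
    rw [map_sum]
    refine Finset.sum_congr rfl fun i _ => ?_
    rw [mul_smul_comm, map_smul]
    rfl
  rw [hb, mD, Finset.sum_mul, Finset.mul_sum, ← Finset.sum_add_distrib]
  refine Finset.sum_congr rfl fun i _ => ?_
  have h := mI_mI (a * v i) b
  have h2 : mI (a * v i) * (mI b * mK (v.coord i)) = -(mI b * (mI (a * v i) * mK (v.coord i))) := by
    rw [← mul_assoc, h, ← mul_assoc]
    exact neg_mul (mI b * mI (a * v i)) (mK (v.coord i))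
  rw [mul_assoc, mK_mI, mul_sub, h2, mul_smul_comm, mul_one]
  abel

lemma mD_mC (a b : F) : mD v a * mC τ b = mC τ b * mD v a - mC τ (a * b) := by
  have : mD v a * mC τ b - mC τ b * mD v a + mC τ (a * b) = 0 := by
    apply op_zero _ _ (-1)
    · intro c
      rw [add_mul, sub_mul, mul_assoc, mC_mI, mul_assoc, mD_mI, mC_mI, mul_sub, mul_add,
        ← mul_assoc, ← mul_assoc, mD_mI, mC_mI, mC_mI]
      simp only [mul_smul_comm, mul_one, mul_add, mul_sub, add_mul, sub_mul, smul_mul_assoc,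
        one_mul, neg1_smul, mul_assoc, mul_left_comm b a c]
      abel
    · simp [mD_one, mC, mK_one]
  rw [← sub_eq_zero, ← this]; abel

lemma mD_mD (a b : F) : mD v a * mD v b = mD v b * mD v a := by
  have : mD v a * mD v b - mD v b * mD v a = 0 := by
    apply op_zero _ _ 1
    · intro c
      rw [sub_mul, mul_assoc, mul_assoc, mD_mI, mD_mI, mul_add, mul_add,
        ← mul_assoc, ← mul_assoc, mD_mI, mD_mI, mD_mI, mD_mI]
      simp only [mul_sub, add_mul, one_smul, mul_assoc, mul_left_comm b a c]
      abel
    · simp [mD_one]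
  exact sub_eq_zero.1 this

/-- The model representation. -/
noncomputable def modelRep (t : F) : CurrentRep (ExteriorAlgebra ℂ F) where
  E i j r := if i = 0 then (if j = 0 then τ (t ^ r) • 1 - mD v (t ^ r) else mC τ (t ^ r))
    else (if j = 0 then mI (t ^ r) else mD v (t ^ r))
  rel i j k l r s := by
    have h4 : (-1 : ℂ) ^ 4 = 1 := by norm_num
    have hII := mI_mI (t ^ r) (t ^ s)
    have hCC := mC_mC τ (t ^ r) (t ^ s)
    have hDD := mD_mD v (t ^ r) (t ^ s)
    have hCI := mC_mI τ (t ^ r) (t ^ s)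
    have hCI' := mC_mI τ (t ^ s) (t ^ r)
    have hDI := mD_mI v (t ^ r) (t ^ s)
    have hDI' := mD_mI v (t ^ s) (t ^ r)
    have hDC := mD_mC v τ (t ^ r) (t ^ s)
    have hDC' := mD_mC v τ (t ^ s) (t ^ r)
    rw [← pow_add] at hCI hCI' hDI hDI' hDC hDC'
    rw [add_comm s r] at hCI' hDI' hDC'
    fin_cases i <;> fin_cases j <;> fin_cases k <;> fin_cases l <;>
    simp [sub_mul, mul_sub, hII, hCC, hDD, hCI, hCI', hDI, hDI', hDC, hDC', smul_sub,
      smul_comm (τ (t ^ r)) (τ (t ^ s)), neg1_smul, h4]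
    all_goals (try abel)

end model

section dimension
variable {k : ℕ} {b : Fin k → ℂ} {nn : Fin k → ℕ}

/-- the trace functional -/
noncomputable def tauP (k : ℕ) (b : Fin k → ℂ) (nn : Fin k → ℕ) (hnn : ∀ s, 0 < nn s) :
    AdjoinRoot (etaP k b nn) →ₗ[ℂ] ℂ :=
  ∑ s, (nn s : ℂ) • (AdjoinRoot.liftAlgHom (etaP k b nn) (Algebra.ofId ℂ ℂ) (b s) (by
    have : (etaP k b nn).eval (b s) = 0 := by
      rw [etaP, eval_prod]
      refine Finset.prod_eq_zero (Finset.mem_univ s) ?_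
      simp [(hnn s).ne']
    simpa [Polynomial.eval₂_eq_eval_map] using this)).toLinearMap

lemma tauP_root_pow (hnn : ∀ s, 0 < nn s) (r : ℕ) :
    tauP k b nn hnn (AdjoinRoot.root _ ^ r) = ∑ s, (nn s : ℂ) * b s ^ r := by
  simp [tauP, LinearMap.sum_apply]

lemma model_exists (k : ℕ) (b : Fin k → ℂ) (nn : Fin k → ℕ) (hnn : ∀ s, 0 < nn s) :
    ∃ ρ' : CurrentRep (ExteriorAlgebra ℂ (AdjoinRoot (etaP k b nn))),
      IsWeylVec k b nn ρ' 1 := by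
  have hmon := etaP_monic k b nn
  let v := (AdjoinRoot.powerBasis' hmon).basis
  let τ := tauP k b nn hnn
  let ρ' := modelRep v τ (AdjoinRoot.root (etaP k b nn))
  have h10 : ∀ r, ρ'.E 1 0 r = mI (AdjoinRoot.root (etaP k b nn) ^ r) := fun r => by
    simp [ρ', modelRep]
  have hp : ∀ f : ℂ[X], polyAct (ρ'.E 1 0) f = mI (AdjoinRoot.mk (etaP k b nn) f) := by
    intro f
    have : polyAct (ρ'.E 1 0) = mIl ∘ₗ (AdjoinRoot.mkₐ (etaP k b nn)).toLinearMap := by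
      apply poly_lin_ext
      intro n
      rw [polyAct_X_pow, h10]
      simp [mIl]
    rw [this]
    rfl
  refine ⟨ρ', ?_, ?_, ?_, ?_, ?_⟩
  · intro r
    simp [ρ', modelRep, mD_one, τ, tauP_root_pow]
  · intro r
    simp [ρ', modelRep, mD_one]
  · intro r
    simp [ρ', modelRep, mC, mK_one]
  · rw [eta_sum (fun i => ρ'.E 1 0 i 1)]
    have h2 : polyAct (fun i => ρ'.E 1 0 i 1) = (LinearMap.applyₗ 1) ∘ₗ polyAct (ρ'.E 1 0) := by
      apply poly_lin_ext
      intro n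
      simp [polyAct_X_pow]
    rw [h2, LinearMap.comp_apply, hp, AdjoinRoot.mk_self]
    simp [mI]
  · intro P hP h1
    rw [eq_top_iff]
    intro x _
    induction x using ext_ind with
    | h1 => exact h1
    | hs c x hx => exact P.smul_mem c (hx trivial)
    | hadd x y hx hy => exact P.add_mem (hx trivial) (hy trivial)
    | hI a x hx =>
      obtain ⟨f, rfl⟩ := AdjoinRoot.mk_surjective a
      rw [← hp, polyAct_apply, Polynomial.sum, LinearMap.sum_apply]
      refine P.sum_mem fun i _ => ?_
      exact P.smul_mem _ (hP 1 0 i x (hx trivial))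

lemma rank_ext (k : ℕ) (b : Fin k → ℂ) (nn : Fin k → ℕ) :
    Module.rank ℂ (ExteriorAlgebra ℂ (AdjoinRoot (etaP k b nn))) = 2 ^ (∑ s, nn s) := by
  have hmon := etaP_monic k b nn
  let v := (AdjoinRoot.powerBasis' hmon).basis
  have h := rank_eq_card_basis v.ExteriorAlgebra
  rw [h, Fintype.card_finset, Fintype.card_fin]
  change ((2 ^ (etaP k b nn).natDegree : ℕ) : Cardinal) = _
  rw [etaP_natDegree]
  push_cast
  rfl

lemma weyl_rank (hnn : ∀ s, 0 < nn s) {W : Type} [AddCommGroup W] [Module ℂ W]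
    {ρ : CurrentRep W} {w : W} (hW : IsWeylModule k b nn W ρ w) :
    Module.rank ℂ W = 2 ^ (∑ s, nn s) := by
  obtain ⟨hw, huniv⟩ := hW
  apply le_antisymm
  · obtain ⟨f, hf⟩ := exists_ext_surj hw
    rw [← rank_ext k b nn]
    exact LinearMap.rank_le_of_surjective f hf
  · obtain ⟨ρ', h'⟩ := model_exists k b nn hnn
    obtain ⟨f, hfw, hf⟩ := huniv _ ρ' 1 h'
    rw [← rank_ext k b nn]
    refine LinearMap.rank_le_of_surjective f ?_
    rw [← LinearMap.range_eq_top]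
    apply h'.2.2.2.2
    · rintro i j r _ ⟨y, rfl⟩
      exact ⟨_, hf i j r y⟩
    · exact ⟨w, hfw⟩

end dimension

section tensor
variable {k : ℕ} {Wf : Fin k → Type}
    [∀ s, AddCommGroup (Wf s)] [∀ s, Module ℂ (Wf s)]
    (ρf : ∀ s, GradedCurrentRep (Wf s))

/-- `J^p ⊗ ... ⊗ J^p ⊗ A ⊗ 1 ⊗ ... ⊗ 1` -/
noncomputable def Tl (p : ℕ) (s : Fin k) :
    Module.End ℂ (Wf s) →ₗ[ℂ] Module.End ℂ (⨂[ℂ] s, Wf s) :=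
  (PiTensorProduct.mapMultilinear ℂ Wf Wf).toLinearMap
    (fun u => if u < s then (ρf u).J ^ p else 1) s

lemma Tl_apply (p : ℕ) (s : Fin k) (A : Module.End ℂ (Wf s)) :
    Tl ρf p s A = PiTensorProduct.map
      (Function.update (fun u => if u < s then (ρf u).J ^ p else 1) s A) := rfl

lemma tensorE_eq (i j : Fin 2) (r : ℕ) :
    tensorE ρf i j r = ∑ s, Tl ρf ((i : ℕ) + (j : ℕ)) s ((ρf s).E i j r) := by
  unfold tensorE
  refine Finset.sum_congr rfl fun s _ => ?_
  rw [Tl_apply]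
  congr 1
  funext u
  rcases lt_trichotomy u s with h | rfl | h
  · simp [h, h.ne]
  · simp
  · simp [h.ne', h.not_gt]

lemma Tl_tprod (p : ℕ) (s : Fin k) (A : Module.End ℂ (Wf s)) (x : ∀ u, Wf u) :
    Tl ρf p s A (PiTensorProduct.tprod ℂ x) = PiTensorProduct.tprod ℂ
      (Function.update (fun u => if u < s then ((ρf u).J ^ p) (x u) else x u) s (A (x s))) := by
  rw [Tl_apply, PiTensorProduct.map_tprod]
  congr 1
  funext u
  rcases lt_trichotomy u s with h | rfl | h
  · simp [h, h.ne]
  · simp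
  · simp [h.ne', h.not_gt]

lemma Tl_mul_same (p q : ℕ) (s : Fin k) (A B : Module.End ℂ (Wf s)) :
    Tl ρf p s A * Tl ρf q s B = Tl ρf (p + q) s (A * B) := by
  rw [Tl_apply, Tl_apply, Tl_apply, ← PiTensorProduct.map_mul]
  congr 1
  funext u
  rcases lt_trichotomy u s with h | rfl | h
  · simp [h, h.ne, pow_add]
  · simp
  · simp [h.ne', h.not_gt]

lemma Tl_parity (p q : ℕ) (h : p % 2 = q % 2) (s : Fin k) : Tl ρf p s = Tl ρf q s := by
  have : ∀ u, (ρf u).J ^ p = (ρf u).J ^ q := by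
    intro u
    have h2 : (ρf u).J ^ 2 = 1 := by rw [pow_two, (ρf u).J_sq]
    rw [← Nat.div_add_mod p 2, ← Nat.div_add_mod q 2, pow_add, pow_add, pow_mul, pow_mul, h2, h]
    simp
  unfold Tl
  simp only [this]

lemma J_pow_comm {V : Type} [AddCommGroup V] [Module ℂ V] (J A : Module.End ℂ V) (p q : ℕ)
    (h : J * A = ((-1 : ℂ) ^ p) • (A * J)) :
    J ^ q * A = ((-1 : ℂ) ^ (p * q)) • (A * J ^ q) := by
  induction q with
  | zero => simp
  | succ q ih =>
    rw [pow_succ', mul_assoc, ih, mul_smul_comm, ← mul_assoc, h, smul_mul_assoc, smul_smul,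
      mul_assoc, ← pow_add, ← pow_succ']
    congr 2

lemma Tl_mul_lt (p q : ℕ) (s u : Fin k) (hsu : s < u) (A : Module.End ℂ (Wf s))
    (B : Module.End ℂ (Wf u)) (h : (ρf s).J * A = ((-1 : ℂ) ^ p) • (A * (ρf s).J)) :
    Tl ρf q u B * Tl ρf p s A = ((-1 : ℂ) ^ (p * q)) • (Tl ρf p s A * Tl ρf q u B) := by
  have hJ := J_pow_comm _ _ p q h
  rw [Tl_apply, Tl_apply, ← PiTensorProduct.map_mul, ← PiTensorProduct.map_mul]
  set g : ∀ v, Module.End ℂ (Wf v) := fun i =>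
    Function.update (fun u ↦ if u < s then (ρf u).J ^ p else 1) s A i *
        Function.update (fun u_1 ↦ if u_1 < u then (ρf u_1).J ^ q else 1) u B i with hg
  have hgs : g = Function.update g s (A * (ρf s).J ^ q) := by
    rw [Function.eq_update_iff]
    simp [hg, hsu, hsu.ne]
  rw [hgs, ← PiTensorProduct.map_update_smul, ← hJ]
  congr 1
  funext v
  rcases lt_trichotomy v s with hv | rfl | hv
  · have hvu := hv.trans hsu
    simp [hv.ne, hv, hvu, hvu.ne, hg, ← pow_add, add_comm]
  · simp [hsu.ne, hsu]
  · simp [hv.ne', hg, hv.not_gt]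

lemma Tl_mul_ne (p q : ℕ) (s u : Fin k) (hsu : s ≠ u) (A : Module.End ℂ (Wf s))
    (B : Module.End ℂ (Wf u)) (hA : (ρf s).J * A = ((-1 : ℂ) ^ p) • (A * (ρf s).J))
    (hB : (ρf u).J * B = ((-1 : ℂ) ^ q) • (B * (ρf u).J)) :
    Tl ρf p s A * Tl ρf q u B = ((-1 : ℂ) ^ (p * q)) • (Tl ρf q u B * Tl ρf p s A) := by
  rcases lt_or_gt_of_ne hsu with h | h
  · rw [Tl_mul_lt ρf p q s u h A B hA, smul_smul, ← mul_pow]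
    simp
  · rw [Tl_mul_lt ρf q p u s h B A hB, mul_comm q p]

/-- The tensor product representation. -/
noncomputable def tensorRep : CurrentRep (⨂[ℂ] s, Wf s) where
  E := tensorE ρf
  rel i j k' l r s := by
    have key : tensorE ρf i j r * tensorE ρf k' l s -
        ((-1 : ℂ) ^ (((i : ℕ) + (j : ℕ)) * ((k' : ℕ) + (l : ℕ)))) •
          (tensorE ρf k' l s * tensorE ρf i j r) =
        ∑ v, Tl ρf ((i : ℕ) + j + (k' + l)) v ((ρf v).E i j r * (ρf v).E k' l s -
          ((-1 : ℂ) ^ (((i : ℕ) + (j : ℕ)) * ((k' : ℕ) + (l : ℕ)))) •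
          ((ρf v).E k' l s * (ρf v).E i j r)) := by
      simp only [tensorE_eq, Finset.sum_mul_sum]
      rw [Finset.sum_comm (f := fun a c => Tl ρf (↑k' + ↑l) a ((ρf a).E k' l s) *
        Tl ρf (↑i + ↑j) c ((ρf c).E i j r)), Finset.smul_sum, ← Finset.sum_sub_distrib]
      refine Finset.sum_congr rfl fun v _ => ?_
      rw [Finset.smul_sum, ← Finset.sum_sub_distrib, Finset.sum_eq_single v]
      · rw [Tl_mul_same, Tl_mul_same, map_sub, map_smul, add_comm ((k' : ℕ) + l)]
      · intro u _ hu
        rw [sub_eq_zero]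
        exact Tl_mul_ne ρf _ _ v u (Ne.symm hu) _ _ ((ρf v).J_E i j r) ((ρf u).J_E k' l s)
      · simp
    rw [key]
    simp only [(ρf _).rel, map_sub, map_smul, Finset.sum_sub_distrib, ← Finset.smul_sum]
    congr 1
    · split_ifs with h
      · subst h
        rw [tensorE_eq]
        refine Finset.sum_congr rfl fun v _ => ?_
        rw [Tl_parity ρf _ ((i : ℕ) + l) (by omega)]
      · simp
    · congr 1
      split_ifs with h
      · subst h
        rw [tensorE_eq]
        refine Finset.sum_congr rfl fun v _ => ?_
        rw [Tl_parity ρf _ ((k' : ℕ) + j) (by omega)]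
      · simp

lemma polyAct_tensor (f : ℂ[X]) :
    polyAct (tensorE ρf 1 0) f = ∑ s, Tl ρf 1 s (polyAct ((ρf s).E 1 0) f) := by
  have : polyAct (tensorE ρf 1 0) = ∑ s, Tl ρf 1 s ∘ₗ polyAct ((ρf s).E 1 0) := by
    apply poly_lin_ext
    intro n
    simp [polyAct_X_pow, tensorE_eq, LinearMap.sum_apply]
  rw [this]
  simp [LinearMap.sum_apply]

variable {b : Fin k → ℂ} {nn : Fin k → ℕ} {wf : ∀ s, Wf s}

lemma J_w {V : Type} [AddCommGroup V] [Module ℂ V] (g : GradedCurrentRep V) {k' : ℕ}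
    {b' : Fin k' → ℂ} {n' : Fin k' → ℕ} {w : V} (hw : IsWeylVec k' b' n' g.toCurrentRep w) :
    ∃ c : ℂ, c ≠ 0 ∧ g.J w = c • w := by
  have h0 : g.E 1 1 0 (g.J w) = 0 := by
    have := congrArg (fun f => f w) (g.J_E 1 1 0)
    simp only [Module.End.mul_apply, LinearMap.smul_apply, hw.2.1, map_zero] at this
    simpa using this.symm
  obtain ⟨c, hc⟩ := weight_zero hw h0
  by_cases hc0 : c = 0
  · have h2 := congrArg (fun f => f w) g.J_sq
    simp [hc, hc0] at h2
    exact ⟨1, one_ne_zero, by simp [← h2]⟩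
  · exact ⟨c, hc0, hc⟩

lemma tensor_weyl (hb : Function.Injective b)
    (hWf : ∀ s, IsWeylVec 1 (fun _ => b s) (fun _ => nn s) (ρf s).toCurrentRep (wf s)) :
    IsWeylVec k b nn (tensorRep ρf) (PiTensorProduct.tprod ℂ wf) := by
  have heta1 : ∀ s, etaP 1 (fun _ => b s) (fun _ => nn s) = (X - C (b s)) ^ nn s := by
    intro s; simp [etaP]
  have hkill : ∀ s (f : ℂ[X]), (X - C (b s)) ^ nn s ∣ f → polyAct ((ρf s).E 1 0) f = 0 := by
    intro s f hf
    exact eta_kill (hWf s) (by rwa [heta1])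
  refine ⟨?_, ?_, ?_, ?_, ?_⟩
  · intro r
    change tensorE ρf 0 0 r _ = _
    rw [tensorE_eq, LinearMap.sum_apply, Finset.sum_smul]
    refine Finset.sum_congr rfl fun s _ => ?_
    rw [Tl_tprod, (hWf s).1]
    simp
  · intro r
    change tensorE ρf 1 1 r _ = _
    rw [tensorE_eq, LinearMap.sum_apply]
    refine Finset.sum_eq_zero fun s _ => ?_
    rw [Tl_tprod, (hWf s).2.1, MultilinearMap.map_update_zero]
  · intro r
    change tensorE ρf 0 1 r _ = _
    rw [tensorE_eq, LinearMap.sum_apply]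
    refine Finset.sum_eq_zero fun s _ => ?_
    rw [Tl_tprod, (hWf s).2.2.1, MultilinearMap.map_update_zero]
  · have h := polyAct_tensor ρf (etaP k b nn)
    have h0 : polyAct (tensorE ρf 1 0) (etaP k b nn) = 0 := by
      rw [h]
      refine Finset.sum_eq_zero fun s _ => ?_
      rw [hkill s (etaP k b nn) (Finset.dvd_prod_of_mem (fun u => (X - C (b u)) ^ nn u) (Finset.mem_univ s)), map_zero]
    rw [← eta_sum] at h0
    have := congrArg (fun f => f (PiTensorProduct.tprod ℂ wf)) h0
    simpa [LinearMap.sum_apply, tensorRep] using this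
  · intro P hP hwP
    have hpoly : ∀ f : ℂ[X], ∀ x ∈ P, polyAct (tensorE ρf 1 0) f x ∈ P := by
      intro f x hx
      rw [polyAct_apply, Polynomial.sum, LinearMap.sum_apply]
      refine P.sum_mem fun i _ => ?_
      exact P.smul_mem _ (hP 1 0 i x hx)
    have hT : ∀ (s : Fin k) (r : ℕ), ∀ x ∈ P, Tl ρf 1 s ((ρf s).E 1 0 r) x ∈ P := by
      intro s r x hx
      have hcop : IsCoprime ((X - C (b s)) ^ nn s)
          (∏ u ∈ Finset.univ.erase s, (X - C (b u)) ^ nn u) := by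
        apply IsCoprime.prod_right
        intro u hu
        apply IsCoprime.pow
        apply isCoprime_X_sub_C_of_isUnit_sub
        rw [isUnit_iff_ne_zero, sub_ne_zero]
        exact fun h => (Finset.ne_of_mem_erase hu) (hb h).symm
      obtain ⟨a, c, hac⟩ := hcop
      set q := ∏ u ∈ Finset.univ.erase s, (X - C (b u)) ^ nn u with hq
      have hf := hpoly (X ^ r * (c * q)) x hx
      rw [polyAct_tensor, Finset.sum_eq_single s] at hf
      · have h1 : polyAct ((ρf s).E 1 0) (X ^ r * (c * q)) = (ρf s).E 1 0 r := by
          have h2 : X ^ r * (c * q) = X ^ r - X ^ r * (a * (X - C (b s)) ^ nn s) := by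
            linear_combination (X ^ r) * hac
          rw [h2, map_sub, polyAct_X_pow,
            hkill s (X ^ r * (a * (X - C (b s)) ^ nn s)) ⟨X ^ r * a, by ring⟩, sub_zero]
        rwa [h1] at hf
      · intro u _ hu
        rw [hkill u, map_zero]
        refine Dvd.dvd.mul_left (Dvd.dvd.mul_left ?_ _) _
        exact Finset.dvd_prod_of_mem (fun u => (X - C (b u)) ^ nn u)
          (Finset.mem_erase.2 ⟨hu, Finset.mem_univ u⟩)
      · simp
    choose ε hε0 hε using fun u => J_w (ρf u) (hWf u)
    have hS : ∀ d t : ℕ, t + d = k → ∀ x : ∀ u, Wf u, (∀ u : Fin k, u.val < t → x u = wf u) →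
        PiTensorProduct.tprod ℂ x ∈ P := by
      intro d
      induction d with
      | zero =>
        intro t ht x hx
        have : x = wf := funext fun u => hx u (by omega)
        rw [this]; exact hwP
      | succ d ih =>
        intro t ht x hx
        let s : Fin k := ⟨t, by omega⟩
        let Q : Submodule ℂ (Wf s) := P.comap ((PiTensorProduct.tprod ℂ).toLinearMap x s)
        have hQ : Q = ⊤ := by
          apply closed10_top (hWf s)
          · change PiTensorProduct.tprod ℂ (Function.update x s (wf s)) ∈ P
            apply ih (t + 1) (by omega)
            intro u hu
            by_cases hus : u = s
            · subst hus; simp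
            · rw [Function.update_of_ne hus]
              apply hx
              have : u.val ≠ t := fun h => hus (Fin.ext h)
              omega
          · intro r y hy
            change PiTensorProduct.tprod ℂ (Function.update x s y) ∈ P at hy
            change PiTensorProduct.tprod ℂ (Function.update x s ((ρf s).E 1 0 r y)) ∈ P
            have h := hT s r _ hy
            rw [Tl_tprod] at h
            have heq : (Function.update (fun u => if u < s then ((ρf u).J ^ 1)
                (Function.update x s y u) else Function.update x s y u) s
                ((ρf s).E 1 0 r (Function.update x s y s))) =
                fun u => (if u < s then ε u else 1) •
                  Function.update x s ((ρf s).E 1 0 r y) u := by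
              funext u
              rcases lt_trichotomy u s with hu | rfl | hu
              · simp [hu, hu.ne, hx u hu, hε]
              · simp
              · simp [hu.ne', hu.not_gt]
            rw [heq, MultilinearMap.map_smul_univ] at h
            refine (P.smul_mem_iff ?_).1 h
            rw [Finset.prod_ne_zero_iff]
            intro u _
            split_ifs
            · exact hε0 u
            · exact one_ne_zero
        have hm : x s ∈ Q := by rw [hQ]; trivial
        change PiTensorProduct.tprod ℂ (Function.update x s (x s)) ∈ P at hm
        rwa [Function.update_eq_self] at hm
    rw [eq_top_iff, ← PiTensorProduct.span_tprod_eq_top, Submodule.span_le]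
    rintro _ ⟨x, rfl⟩
    exact hS k 0 (by omega) x (fun u hu => absurd hu (by omega))

lemma finrank_piTensor [∀ s, Module.Finite ℂ (Wf s)] :
    Module.finrank ℂ (⨂[ℂ] s, Wf s) = ∏ s, Module.finrank ℂ (Wf s) := by
  rw [Module.finrank_eq_card_basis
    (Basis.piTensorProduct (fun s => Module.finBasis ℂ (Wf s)))]
  simp

end tensor

end WeylHelpers

/-- If `η(x) = Π_s (x − b_s)^{n_s}` with `b₁,...,b_k` pairwise distinct,
then the Weyl module `W_η` is isomorphic as a `gl(1|1)[t]`-module to the tensor product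
`W_{n_1}(b_1) ⊗ ... ⊗ W_{n_k}(b_k)`; in particular `dim W_η = 2^{n_1 + ... + n_k}`. -/
theorem weyl_module_tensor_factorization
    (k : ℕ) (b : Fin k → ℂ) (hb : Function.Injective b)
    (nn : Fin k → ℕ) (hnn : ∀ s, 0 < nn s)
    (W : Type) [AddCommGroup W] [Module ℂ W] (ρ : CurrentRep W) (w : W)
    (hW : IsWeylModule k b nn W ρ w)
    (Wf : Fin k → Type) [∀ s, AddCommGroup (Wf s)] [∀ s, Module ℂ (Wf s)]
    (ρf : ∀ s, GradedCurrentRep (Wf s)) (wf : ∀ s, Wf s)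
    (hWf : ∀ s, IsWeylModule 1 (fun _ => b s) (fun _ => nn s) (Wf s)
      (ρf s).toCurrentRep (wf s)) :
    (∃ φ : W ≃ₗ[ℂ] ⨂[ℂ] s, Wf s,
      ∀ (i j : Fin 2) (r : ℕ) (x : W), φ (ρ.E i j r x) = tensorE ρf i j r (φ x)) ∧
    Module.rank ℂ W = 2 ^ (∑ s, nn s) := by
  have hrank := weyl_rank hnn hW
  refine ⟨?_, hrank⟩
  have hrankf : ∀ s, Module.rank ℂ (Wf s) = 2 ^ nn s := by
    intro s
    have := weyl_rank (fun _ => hnn s) (hWf s)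
    simpa using this
  have hfin : Module.Finite ℂ W := by
    rw [← Module.rank_lt_aleph0_iff, hrank]
    exact_mod_cast Cardinal.natCast_lt_aleph0 (n := 2 ^ (∑ s, nn s))
  have hfinf : ∀ s, Module.Finite ℂ (Wf s) := by
    intro s
    rw [← Module.rank_lt_aleph0_iff, hrankf]
    exact_mod_cast Cardinal.natCast_lt_aleph0 (n := 2 ^ nn s)
  have hfr : Module.finrank ℂ W = Module.finrank ℂ (⨂[ℂ] s, Wf s) := by
    rw [finrank_piTensor]
    have h1 : Module.finrank ℂ W = 2 ^ (∑ s, nn s) :=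
      Module.finrank_eq_of_rank_eq (by rw [hrank]; push_cast; rfl)
    have h2 : ∀ s, Module.finrank ℂ (Wf s) = 2 ^ nn s := fun s =>
      Module.finrank_eq_of_rank_eq (by rw [hrankf]; push_cast; rfl)
    rw [h1, Finset.prod_congr rfl (fun s _ => h2 s), Finset.prod_pow_eq_pow_sum]
  have hT := tensor_weyl ρf hb (fun s => (hWf s).1)
  obtain ⟨f, hfw, hf⟩ := hW.2 _ (tensorRep ρf) _ hT
  have hsurj : Function.Surjective f := by
    rw [← LinearMap.range_eq_top]
    apply hT.2.2.2.2
    · rintro i j r _ ⟨y, rfl⟩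
      exact ⟨_, hf i j r y⟩
    · exact ⟨w, hfw⟩
  haveI : Module.Finite ℂ (⨂[ℂ] s, Wf s) := Module.Finite.of_surjective f hsurj
  have hinj : Function.Injective f :=
    (LinearMap.injective_iff_surjective_of_finrank_eq_finrank hfr).2 hsurj
  exact ⟨LinearEquiv.ofBijective f ⟨hinj, hsurj⟩, fun i j r x => hf i j r x⟩
end

section
/- A gl(1|1)[t]-module M is an irreducible subquotient of the Weyl module W_m(b) if and only if M is isomorphic to an evaluation module L_λ(b) where λ is a polynomial gl(1|1)-weight with λ_1 + λ_2 = m. -/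
set_option synthInstance.maxHeartbeats 1000000
set_option maxHeartbeats 1000000

/-- The defining property of the Weyl module `W_m(b)` (for `η(x) = (x−b)^m`), together with
its universality. -/
def IsWeylVecSingle (m : ℕ) (b : ℂ) {W : Type} [AddCommGroup W] [Module ℂ W]
    (ρ : CurrentRep W) (w : W) : Prop :=
  (∀ r : ℕ, ρ.E 0 0 r w = ((m : ℂ) * b ^ r) • w) ∧
  (∀ r : ℕ, ρ.E 1 1 r w = 0) ∧ (∀ r : ℕ, ρ.E 0 1 r w = 0) ∧
  (∑ i ∈ Finset.range (m + 1),
      (((Polynomial.X - Polynomial.C b) ^ m : Polynomial ℂ).coeff i) • ρ.E 1 0 i w = 0) ∧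
  ρ.IsCyclic w

/-- `(W, ρ, w)` is the Weyl module `W_m(b)`. -/
def IsWeylModuleSingle (m : ℕ) (b : ℂ) (W : Type) [AddCommGroup W] [Module ℂ W]
    (ρ : CurrentRep W) (w : W) : Prop :=
  IsWeylVecSingle m b ρ w ∧
  ∀ (W' : Type) [AddCommGroup W'] [Module ℂ W'] (ρ' : CurrentRep W') (w' : W'),
    IsWeylVecSingle m b ρ' w' →
      ∃ f : W →ₗ[ℂ] W', f w = w' ∧ ∀ (i j : Fin 2) (r : ℕ) (x : W),
        f (ρ.E i j r x) = ρ'.E i j r (f x)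

/-- Irreducibility of a `gl(1|1)[t]`-module. -/
def CurrentRep.IsIrreducible {M : Type} [AddCommGroup M] [Module ℂ M]
    (ρ : CurrentRep M) : Prop :=
  (∃ x : M, x ≠ 0) ∧
  ∀ P : Submodule ℂ M, (∀ (i j : Fin 2) (r : ℕ) (x : M), x ∈ P → ρ.E i j r x ∈ P) →
    P = ⊥ ∨ P = ⊤

/-- `ρ` is an evaluation module at `b`: `e_{ij}[r]` acts as `bʳ · e_{ij}[0]`. -/
def CurrentRep.IsEvaluationAt {M : Type} [AddCommGroup M] [Module ℂ M]
    (ρ : CurrentRep M) (b : ℂ) : Prop :=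
  ∀ (i j : Fin 2) (r : ℕ), ρ.E i j r = b ^ r • ρ.E i j 0

namespace CurrentRep

open Polynomial

variable {W W' : Type} [AddCommGroup W] [Module ℂ W] [AddCommGroup W'] [Module ℂ W']

theorem eq_of_E {ρ σ : CurrentRep W} (h : ∀ i j r, ρ.E i j r = σ.E i j r) : ρ = σ := by
  cases ρ with
  | mk E hE =>
    cases σ with
    | mk F hF =>
      have : E = F := by
        funext i j r
        exact h i j r
      subst this
      rfl

/-- Linear extension of `E i j` to polynomials in `t`. -/
noncomputable def Ep (ρ : CurrentRep W) (i j : Fin 2) : ℂ[X] →ₗ[ℂ] Module.End ℂ W :=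
  (Polynomial.basisMonomials ℂ).constr ℂ (ρ.E i j)

theorem Ep_monomial_one (ρ : CurrentRep W) (i j : Fin 2) (r : ℕ) :
    ρ.Ep i j (monomial r 1) = ρ.E i j r := by
  have := (Polynomial.basisMonomials ℂ).constr_basis ℂ (ρ.E i j) r
  rwa [Polynomial.coe_basisMonomials] at this

theorem Ep_monomial (ρ : CurrentRep W) (i j : Fin 2) (r : ℕ) (a : ℂ) :
    ρ.Ep i j (monomial r a) = a • ρ.E i j r := by
  rw [← Ep_monomial_one, ← map_smul, smul_monomial, smul_eq_mul, mul_one]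

theorem Ep_X_pow (ρ : CurrentRep W) (i j : Fin 2) (r : ℕ) :
    ρ.Ep i j (X ^ r) = ρ.E i j r := by
  rw [← Ep_monomial_one, X_pow_eq_monomial]

theorem Ep_rel (ρ : CurrentRep W) (i j k l : Fin 2) (p q : ℂ[X]) :
    ρ.Ep i j p * ρ.Ep k l q -
        ((-1 : ℂ) ^ (((i : ℕ) + (j : ℕ)) * ((k : ℕ) + (l : ℕ)))) • (ρ.Ep k l q * ρ.Ep i j p) =
      (if j = k then ρ.Ep i l (p * q) else 0) -
        ((-1 : ℂ) ^ (((i : ℕ) + (j : ℕ)) * ((k : ℕ) + (l : ℕ)))) •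
          (if i = l then ρ.Ep k j (p * q) else 0) := by
  have ite_add' : ∀ (c : Prop) [Decidable c] (a b : Module.End ℂ W),
      (if c then a + b else 0) = (if c then a else 0) + (if c then b else 0) := by
    intro c _ a b; split_ifs <;> simp
  have ite_smul' : ∀ (c : Prop) [Decidable c] (z : ℂ) (a : Module.End ℂ W),
      (if c then z • a else 0) = z • (if c then a else 0) := by
    intro c _ z a; split_ifs <;> simp
  induction p using Polynomial.induction_on' with
  | add p p' hp hp' =>
    simp only [map_add, add_mul, mul_add, ite_add', smul_add] at *
    rw [add_sub_add_comm, hp, hp', add_sub_add_comm]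
  | monomial r a =>
    induction q using Polynomial.induction_on' with
    | add p p' hp hp' =>
      simp only [map_add, add_mul, mul_add, ite_add', smul_add] at *
      rw [add_sub_add_comm, hp, hp', add_sub_add_comm]
    | monomial s c =>
      have h := ρ.rel i j k l r s
      simp only [monomial_mul_monomial, Ep_monomial, ite_smul']
      rw [smul_mul_smul_comm, smul_mul_smul_comm, mul_comm c a, smul_comm _ (a * c),
        smul_comm _ (a * c), ← smul_sub, ← smul_sub, h]

/-- Change of variable `t ↦ t - c`. -/
noncomputable def shift (ρ : CurrentRep W) (c : ℂ) : CurrentRep W where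
  E i j r := ρ.Ep i j ((X - C c) ^ r)
  rel i j k l r s := by
    rw [Ep_rel, pow_add]

theorem shift_E (ρ : CurrentRep W) (c : ℂ) (i j : Fin 2) (r : ℕ) :
    (ρ.shift c).E i j r = ρ.Ep i j ((X - C c) ^ r) := rfl

theorem shift_Ep (ρ : CurrentRep W) (c : ℂ) (i j : Fin 2) (p : ℂ[X]) :
    (ρ.shift c).Ep i j p = ρ.Ep i j (p.comp (X - C c)) := by
  induction p using Polynomial.induction_on' with
  | add p p' hp hp' => simp only [map_add, add_comp, hp, hp']
  | monomial r a =>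
    rw [Ep_monomial, shift_E, monomial_comp, ← smul_eq_C_mul, map_smul]

theorem shift_shift (ρ : CurrentRep W) (c : ℂ) : (ρ.shift c).shift (-c) = ρ := by
  apply eq_of_E
  intro i j r
  rw [shift_E, shift_Ep, ← Ep_X_pow]
  simp

theorem shift_shift' (ρ : CurrentRep W) (c : ℂ) : (ρ.shift (-c)).shift c = ρ := by
  simpa using ρ.shift_shift (-c)

theorem shift_zero_E (ρ : CurrentRep W) (c : ℂ) (i j : Fin 2) :
    (ρ.shift c).E i j 0 = ρ.E i j 0 := by
  rw [shift_E, ← Ep_X_pow]; simp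

theorem eval_of_shift (ρ : CurrentRep W) (c : ℂ) (h : ∀ i j r, 0 < r → (ρ.shift c).E i j r = 0) :
    ρ.IsEvaluationAt c := by
  intro i j r
  have key : ∀ p : ℂ[X], (ρ.shift c).Ep i j p = p.eval 0 • ρ.E i j 0 := by
    intro p
    induction p using Polynomial.induction_on' with
    | add p p' hp hp' => simp only [map_add, eval_add, hp, hp', add_smul]
    | monomial r a =>
      rw [Ep_monomial]
      rcases Nat.eq_zero_or_pos r with rfl | hr
      · rw [shift_zero_E]; simp
      · rw [h i j r hr]; simp [hr.ne']
  have h2 := key ((X + C c) ^ r)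
  rw [shift_Ep] at h2
  simpa [Ep_X_pow] using h2

theorem shift_of_eval (ρ : CurrentRep W) (c : ℂ) (h : ρ.IsEvaluationAt c) (i j : Fin 2) (r : ℕ)
    (hr : 0 < r) : (ρ.shift c).E i j r = 0 := by
  have key : ∀ p : ℂ[X], ρ.Ep i j p = p.eval c • ρ.E i j 0 := by
    intro p
    induction p using Polynomial.induction_on' with
    | add p p' hp hp' => simp only [map_add, eval_add, hp, hp', add_smul]
    | monomial r a =>
      rw [Ep_monomial, h i j r, eval_monomial, smul_smul]
  rw [shift_E, key]
  simp [hr.ne']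

/-- Homomorphisms of modules. -/
def Intertw (ρ : CurrentRep W) (σ : CurrentRep W') (f : W →ₗ[ℂ] W') : Prop :=
  ∀ i j r x, f (ρ.E i j r x) = σ.E i j r (f x)

theorem Intertw.Ep {ρ : CurrentRep W} {σ : CurrentRep W'} {f : W →ₗ[ℂ] W'}
    (h : Intertw ρ σ f) (i j : Fin 2) (p : ℂ[X]) (x : W) :
    f (ρ.Ep i j p x) = σ.Ep i j p (f x) := by
  induction p using Polynomial.induction_on' with
  | add p p' hp hp' => simp only [map_add, LinearMap.add_apply, hp, hp']
  | monomial r a => simp only [Ep_monomial, LinearMap.smul_apply, map_smul, h i j r x]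

theorem Intertw.shift {ρ : CurrentRep W} {σ : CurrentRep W'} {f : W →ₗ[ℂ] W'}
    (h : Intertw ρ σ f) (c : ℂ) : Intertw (ρ.shift c) (σ.shift c) f := by
  intro i j r x
  exact h.Ep i j _ x

/-- Invariant subspaces. -/
def Inv (ρ : CurrentRep W) (P : Submodule ℂ W) : Prop :=
  ∀ (i j : Fin 2) (r : ℕ) (x : W), x ∈ P → ρ.E i j r x ∈ P

theorem Inv.Ep {ρ : CurrentRep W} {P : Submodule ℂ W} (h : ρ.Inv P) (i j : Fin 2) (p : ℂ[X])
    (x : W) (hx : x ∈ P) : ρ.Ep i j p x ∈ P := by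
  induction p using Polynomial.induction_on' with
  | add p p' hp hp' =>
    simp only [map_add, LinearMap.add_apply]
    exact P.add_mem hp hp'
  | monomial r a =>
    simp only [Ep_monomial, LinearMap.smul_apply]
    exact P.smul_mem _ (h i j r x hx)

theorem Inv.shift {ρ : CurrentRep W} {P : Submodule ℂ W} (h : ρ.Inv P) (c : ℂ) :
    (ρ.shift c).Inv P := fun i j _ x hx => h.Ep i j _ x hx

theorem Inv.of_shift {ρ : CurrentRep W} {P : Submodule ℂ W} {c : ℂ} (h : (ρ.shift c).Inv P) :
    ρ.Inv P := by
  have := h.shift (-c)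
  rwa [shift_shift] at this

theorem IsCyclic.shift {ρ : CurrentRep W} {w : W} (h : ρ.IsCyclic w) (c : ℂ) :
    (ρ.shift c).IsCyclic w := fun P hP hw => h P (Inv.of_shift hP) hw

theorem IsIrreducible.shift {ρ : CurrentRep W} (h : ρ.IsIrreducible) (c : ℂ) :
    (ρ.shift c).IsIrreducible := ⟨h.1, fun P hP => h.2 P (Inv.of_shift hP)⟩

/-- Restriction to an invariant subspace. -/
def restr (ρ : CurrentRep W) (P : Submodule ℂ W) (h : ρ.Inv P) : CurrentRep P where
  E i j r := (ρ.E i j r).restrict (h i j r)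
  rel i j k l r s := by
    ext x
    have := congrArg (fun T : Module.End ℂ W => T x) (ρ.rel i j k l r s)
    split_ifs <;> simp_all

theorem restr_intertw (ρ : CurrentRep W) (P : Submodule ℂ W) (h : ρ.Inv P) :
    Intertw (ρ.restr P h) ρ P.subtype := fun _ _ _ _ => rfl

/-- Direct sum. -/
def prod (ρ : CurrentRep W) (σ : CurrentRep W') : CurrentRep (W × W') where
  E i j r := (ρ.E i j r).prodMap (σ.E i j r)
  rel i j k l r s := by
    apply LinearMap.ext
    rintro ⟨x, y⟩
    have h1 := congrArg (fun T : Module.End ℂ W => T x) (ρ.rel i j k l r s)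
    have h2 := congrArg (fun T : Module.End ℂ W' => T y) (σ.rel i j k l r s)
    split_ifs <;> simp_all

theorem prod_E (ρ : CurrentRep W) (σ : CurrentRep W') (i j r) (x : W × W') :
    (ρ.prod σ).E i j r x = (ρ.E i j r x.1, σ.E i j r x.2) := rfl

/-- Highest weight vector conditions for the shifted Weyl module. -/
def WV (m : ℕ) (ρ : CurrentRep W) (w : W) : Prop :=
  (∀ r : ℕ, ρ.E 0 0 r w = (if r = 0 then (m : ℂ) else 0) • w) ∧
  (∀ r : ℕ, ρ.E 1 1 r w = 0) ∧ (∀ r : ℕ, ρ.E 0 1 r w = 0) ∧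
  (∀ r, m ≤ r → ρ.E 1 0 r w = 0) ∧ ρ.IsCyclic w

theorem zero_of_eq_neg {x : W} (h : x = -x) : x = 0 := by
  have h2 : (2 : ℂ) • x = 0 := by
    rw [two_smul]
    nth_rewrite 1 [h]
    simp
  exact (smul_eq_zero.1 h2).resolve_left two_ne_zero

section relations
variable (ρ : CurrentRep W) (r s : ℕ) (x : W)

theorem rAA : ρ.E 0 0 r (ρ.E 0 0 s x) = ρ.E 0 0 s (ρ.E 0 0 r x) := by
  have := congrArg (fun T : Module.End ℂ W => T x) (ρ.rel 0 0 0 0 r s)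
  simpa [sub_eq_zero] using this
theorem rAD : ρ.E 0 0 r (ρ.E 1 1 s x) = ρ.E 1 1 s (ρ.E 0 0 r x) := by
  have := congrArg (fun T : Module.End ℂ W => T x) (ρ.rel 0 0 1 1 r s)
  simpa [sub_eq_zero] using this
theorem rDD : ρ.E 1 1 r (ρ.E 1 1 s x) = ρ.E 1 1 s (ρ.E 1 1 r x) := by
  have := congrArg (fun T : Module.End ℂ W => T x) (ρ.rel 1 1 1 1 r s)
  have h4 : (-1 : ℂ) ^ 4 = 1 := by norm_num
  simpa [sub_eq_zero, h4] using this
theorem rAX : ρ.E 0 0 r (ρ.E 0 1 s x) = ρ.E 0 1 s (ρ.E 0 0 r x) + ρ.E 0 1 (r + s) x := by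
  have := congrArg (fun T : Module.End ℂ W => T x) (ρ.rel 0 0 0 1 r s)
  simpa [sub_eq_iff_eq_add'] using this
theorem rAY : ρ.E 0 0 r (ρ.E 1 0 s x) = ρ.E 1 0 s (ρ.E 0 0 r x) - ρ.E 1 0 (r + s) x := by
  have := congrArg (fun T : Module.End ℂ W => T x) (ρ.rel 0 0 1 0 r s)
  simpa [sub_eq_iff_eq_add', ← sub_eq_add_neg] using this
theorem rDX : ρ.E 1 1 r (ρ.E 0 1 s x) = ρ.E 0 1 s (ρ.E 1 1 r x) - ρ.E 0 1 (r + s) x := by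
  have := congrArg (fun T : Module.End ℂ W => T x) (ρ.rel 1 1 0 1 r s)
  simpa [sub_eq_iff_eq_add', ← sub_eq_add_neg] using this
theorem rDY : ρ.E 1 1 r (ρ.E 1 0 s x) = ρ.E 1 0 s (ρ.E 1 1 r x) + ρ.E 1 0 (r + s) x := by
  have := congrArg (fun T : Module.End ℂ W => T x) (ρ.rel 1 1 1 0 r s)
  simpa [sub_eq_iff_eq_add'] using this
theorem rXX : ρ.E 0 1 r (ρ.E 0 1 s x) = - ρ.E 0 1 s (ρ.E 0 1 r x) := by
  have := congrArg (fun T : Module.End ℂ W => T x) (ρ.rel 0 1 0 1 r s)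
  simpa [add_eq_zero_iff_eq_neg] using this
theorem rYY : ρ.E 1 0 r (ρ.E 1 0 s x) = - ρ.E 1 0 s (ρ.E 1 0 r x) := by
  have := congrArg (fun T : Module.End ℂ W => T x) (ρ.rel 1 0 1 0 r s)
  simpa [add_eq_zero_iff_eq_neg] using this
theorem rXY : ρ.E 0 1 r (ρ.E 1 0 s x) =
    - ρ.E 1 0 s (ρ.E 0 1 r x) + (ρ.E 0 0 (r + s) x + ρ.E 1 1 (r + s) x) := by
  have := congrArg (fun T : Module.End ℂ W => T x) (ρ.rel 0 1 1 0 r s)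
  simp at this
  rw [← this]; abel
theorem rYX : ρ.E 1 0 r (ρ.E 0 1 s x) =
    - ρ.E 0 1 s (ρ.E 1 0 r x) + (ρ.E 0 0 (r + s) x + ρ.E 1 1 (r + s) x) := by
  rw [rXY, add_comm s r]; abel
theorem rYYself : ρ.E 1 0 r (ρ.E 1 0 r x) = 0 := zero_of_eq_neg (ρ.rYY r r x)
theorem rXXself : ρ.E 0 1 r (ρ.E 0 1 r x) = 0 := zero_of_eq_neg (ρ.rXX r r x)
end relations

theorem inv_of {ρ : CurrentRep W} {P : Submodule ℂ W}
    (hA : ∀ r x, x ∈ P → ρ.E 0 0 r x ∈ P) (hD : ∀ r x, x ∈ P → ρ.E 1 1 r x ∈ P)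
    (hX : ∀ r x, x ∈ P → ρ.E 0 1 r x ∈ P) (hY : ∀ r x, x ∈ P → ρ.E 1 0 r x ∈ P) : ρ.Inv P := by
  intro i j r x hx
  fin_cases i <;> fin_cases j
  · exact hA r x hx
  · exact hX r x hx
  · exact hY r x hx
  · exact hD r x hx

/-- Monomials in the lowering operators. -/
def mon (ρ : CurrentRep W) (w : W) : List ℕ → W
  | [] => w
  | s :: l => ρ.E 1 0 s (mon ρ w l)

theorem mon_inv {ρ : CurrentRep W} {w : W} (a d : ℕ → ℂ) (hA : ∀ r, ρ.E 0 0 r w = a r • w)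
    (hD : ∀ r, ρ.E 1 1 r w = d r • w) (hX : ∀ r, ρ.E 0 1 r w = 0) :
    ρ.Inv (Submodule.span ℂ (Set.range (ρ.mon w))) := by
  set P := Submodule.span ℂ (Set.range (ρ.mon w)) with hP
  have ext : ∀ T : Module.End ℂ W, (∀ l, T (ρ.mon w l) ∈ P) → ∀ x ∈ P, T x ∈ P := by
    intro T hT x hx
    have : P ≤ P.comap T := by
      conv_lhs => rw [hP]
      rw [Submodule.span_le]
      rintro _ ⟨l, rfl⟩
      exact hT l
    exact this hx
  have hm : ∀ l, ρ.mon w l ∈ P := fun l => Submodule.subset_span ⟨l, rfl⟩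
  have hY : ∀ r x, x ∈ P → ρ.E 1 0 r x ∈ P := fun r => ext _ fun l => hm (r :: l)
  have hA' : ∀ r x, x ∈ P → ρ.E 0 0 r x ∈ P := by
    intro r
    refine ext _ fun l => ?_
    induction l with
    | nil => simp only [mon, hA]; exact P.smul_mem _ (hm [])
    | cons s l ih =>
      simp only [mon, rAY]
      exact P.sub_mem (hY _ _ ih) (hm ((r + s) :: l))
  have hD' : ∀ r x, x ∈ P → ρ.E 1 1 r x ∈ P := by
    intro r
    refine ext _ fun l => ?_
    induction l with
    | nil => simp only [mon, hD]; exact P.smul_mem _ (hm [])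
    | cons s l ih =>
      simp only [mon, rDY]
      exact P.add_mem (hY _ _ ih) (hm ((r + s) :: l))
  refine inv_of hA' hD' ?_ hY
  intro r
  refine ext _ fun l => ?_
  induction l with
  | nil => simp only [mon, hX]; exact P.zero_mem
  | cons s l ih =>
    simp only [mon, rXY]
    exact P.add_mem (P.neg_mem (hY _ _ ih)) (P.add_mem (hA' _ _ (hm l)) (hD' _ _ (hm l)))

theorem mon_weight {ρ : CurrentRep W} {w : W} (c : ℂ)
    (hD : ρ.E 1 1 0 w = c • w) (l : List ℕ) :
    ρ.E 1 1 0 (ρ.mon w l) = (c + l.length) • ρ.mon w l := by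
  induction l with
  | nil => simp [mon, hD]
  | cons s l ih =>
    simp only [mon, rDY, ih, map_smul, zero_add, List.length_cons]
    push_cast
    module

/-- Too many anticommuting lowering operators give zero. -/
theorem mon_long {ρ : CurrentRep W} (S : Finset ℕ) : ∀ (x : W),
    (∀ r, r ∉ S → ρ.E 1 0 r x = 0) → ∀ l : List ℕ, S.card < l.length → ρ.mon x l = 0 := by
  have mon_append : ∀ (x : W) (l : List ℕ) (s : ℕ), ρ.mon x (l ++ [s]) = ρ.mon (ρ.E 1 0 s x) l := by
    intro x l s
    induction l with
    | nil => rfl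
    | cons a l ih => simp only [List.cons_append, mon, ih]
  have mon_zero : ∀ l, ρ.mon (0 : W) l = 0 := by
    intro l
    induction l with
    | nil => rfl
    | cons a l ih => simp only [mon, ih, map_zero]
  induction S using Finset.strongInduction with
  | H S ih =>
    intro x hx l hl
    rcases List.eq_nil_or_concat l with rfl | ⟨l', s, rfl⟩
    · simp at hl
    · rw [List.concat_eq_append, mon_append]
      by_cases hs : s ∈ S
      · refine ih (S.erase s) (Finset.erase_ssubset hs) _ ?_ _ ?_
        · intro r hr
          by_cases h : r = s
          · subst h; exact ρ.rYYself r x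
          · rw [rYY, hx r (fun h' => hr (Finset.mem_erase.2 ⟨h, h'⟩)), map_zero, neg_zero]
        · rw [Finset.card_erase_of_mem hs]
          have := Finset.card_pos.2 ⟨s, hs⟩
          simp at hl
          omega
      · rw [hx s hs, mon_zero]

end CurrentRep

namespace CurrentRep

open Polynomial

variable {W W' M : Type} [AddCommGroup W] [Module ℂ W] [AddCommGroup W'] [Module ℂ W']
  [AddCommGroup M] [Module ℂ M]

section weyl
variable {m : ℕ} {ρ : CurrentRep W} {w : W}

theorem WV.central (h : WV m ρ w) (r : ℕ) (x : W) :
    ρ.E 0 0 r x + ρ.E 1 1 r x = (if r = 0 then (m : ℂ) else 0) • x := by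
  set c : ℂ := if r = 0 then (m : ℂ) else 0
  let P : Submodule ℂ W := LinearMap.ker (ρ.E 0 0 r + ρ.E 1 1 r - c • (1 : Module.End ℂ W))
  have hmem : ∀ y, y ∈ P ↔ ρ.E 0 0 r y + ρ.E 1 1 r y = c • y := by
    intro y
    simp [P, LinearMap.mem_ker, sub_eq_zero]
  have hinv : ρ.Inv P := by
    apply inv_of <;> intro s y hy <;> rw [hmem] at hy ⊢
    · rw [rAA, ← rAD, ← map_add, hy, map_smul]
    · rw [rAD, rDD, ← map_add, hy, map_smul]
    · rw [rAX, rDX, ← map_smul, ← hy, map_add]; abel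
    · rw [rAY, rDY, ← map_smul, ← hy, map_add]; abel
  have htop := h.2.2.2.2 P hinv ((hmem w).2 (by rw [h.1, h.2.1, add_zero]))
  rw [← hmem, htop]
  trivial

theorem WV.Xzero (h : WV m ρ w) (r : ℕ) (hr : 0 < r) (x : W) : ρ.E 0 1 r x = 0 := by
  let P : Submodule ℂ W := ⨅ r : {r : ℕ // 0 < r}, LinearMap.ker (ρ.E 0 1 r)
  have hmem : ∀ y, y ∈ P ↔ ∀ r, 0 < r → ρ.E 0 1 r y = 0 := by
    intro y
    simp [P, Submodule.mem_iInf]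
  have hinv : ρ.Inv P := by
    apply inv_of <;> intro s y hy <;> rw [hmem] at hy ⊢ <;> intro q hq
    · have := ρ.rAX s q y
      rw [hy q hq, hy (s + q) (by omega), map_zero, add_zero] at this
      exact this.symm
    · have := ρ.rDX s q y
      rw [hy q hq, hy (s + q) (by omega), map_zero, sub_zero] at this
      exact this.symm
    · rw [rXX, hy q hq, map_zero, neg_zero]
    · rw [rXY, hy q hq, h.central, if_neg (by omega)]; simp
  have htop := h.2.2.2.2 P hinv ((hmem w).2 fun r _ => h.2.2.1 r)
  exact (hmem x).1 (htop ▸ trivial) r hr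

theorem WV.Yzero (h : WV m ρ w) (r : ℕ) (hr : m ≤ r) (x : W) : ρ.E 1 0 r x = 0 := by
  let P : Submodule ℂ W := ⨅ r : {r : ℕ // m ≤ r}, LinearMap.ker (ρ.E 1 0 r)
  have hmem : ∀ y, y ∈ P ↔ ∀ r, m ≤ r → ρ.E 1 0 r y = 0 := by
    intro y
    simp [P, Submodule.mem_iInf]
  have hinv : ρ.Inv P := by
    apply inv_of <;> intro s y hy <;> rw [hmem] at hy ⊢ <;> intro q hq
    · have := ρ.rAY s q y
      rw [hy q hq, hy (s + q) (by omega), map_zero, sub_zero] at this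
      exact this.symm
    · have := ρ.rDY s q y
      rw [hy q hq, hy (s + q) (by omega), map_zero, add_zero] at this
      exact this.symm
    · rw [rYX, hy q hq, h.central]
      split_ifs with h0
      · have : m = 0 := by omega
        simp [this]
      · simp
    · rw [rYY, hy q hq, map_zero, neg_zero]
  have htop := h.2.2.2.2 P hinv ((hmem w).2 h.2.2.2.1)
  exact (hmem x).1 (htop ▸ trivial) r hr

theorem WV.Anil (h : WV m ρ w) (r : ℕ) (hr : 0 < r) (x : W) : ∃ n, (ρ.E 0 0 r ^ n) x = 0 := by
  set A := ρ.E 0 0 r with hA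
  have mono : ∀ (y : W) (n k : ℕ), (A ^ n) y = 0 → (A ^ (k + n)) y = 0 := by
    intro y n k hy
    rw [pow_add, Module.End.mul_apply, hy, map_zero]
  have comm : ∀ (T : Module.End ℂ W), (∀ y, A (T y) = T (A y)) → ∀ n y,
      (A ^ n) (T y) = T ((A ^ n) y) := by
    intro T hT n
    induction n with
    | zero => intro y; rfl
    | succ n ih => intro y; rw [pow_succ, Module.End.mul_apply, hT, ih]; rfl
  let P : Submodule ℂ W :=
    { carrier := {y | ∃ n, (A ^ n) y = 0}
      zero_mem' := ⟨0, rfl⟩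
      add_mem' := by
        rintro a c ⟨n, hn⟩ ⟨k, hk⟩
        refine ⟨n + k, ?_⟩
        rw [map_add, mono c k n hk, add_comm n k, mono a n k hn, add_zero]
      smul_mem' := by
        rintro z a ⟨n, hn⟩
        exact ⟨n, by rw [map_smul, hn, smul_zero]⟩ }
  have key : ∀ N n j s (y : W), n + j = N → m ≤ s + j → (A ^ n) y = 0 →
      (A ^ (n + j)) (ρ.E 1 0 s y) = 0 := by
    intro N
    induction N with
    | zero =>
      intro n j s y hN hs hy
      obtain ⟨rfl, rfl⟩ : n = 0 ∧ j = 0 := by omega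
      have : y = 0 := hy
      simp [this]
    | succ N ih =>
      intro n j s y hN hs hy
      rcases Nat.eq_zero_or_pos j with rfl | hj
      · rw [h.Yzero s (by omega), map_zero]
      rcases Nat.eq_zero_or_pos n with rfl | hn
      · have : y = 0 := hy
        simp [this]
      rw [hN, pow_succ, Module.End.mul_apply, hA, rAY, ← hA, map_sub]
      have h1 := ih (n - 1) j s (A y) (by omega) hs (by
        rw [← Module.End.mul_apply, ← pow_succ, Nat.sub_add_cancel hn, hy])
      have h2 := ih n (j - 1) (r + s) y (by omega) (by omega) hy
      rw [show n - 1 + j = N by omega] at h1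
      rw [show n + (j - 1) = N by omega] at h2
      rw [h1, h2, sub_zero]
  have hinv : ρ.Inv P := by
    apply inv_of
    · rintro s y ⟨n, hn⟩
      exact ⟨n, by rw [comm _ (fun y => ρ.rAA r s y), hn, map_zero]⟩
    · rintro s y ⟨n, hn⟩
      exact ⟨n, by rw [comm _ (fun y => ρ.rAD r s y), hn, map_zero]⟩
    · rintro s y ⟨n, hn⟩
      refine ⟨n, ?_⟩
      rw [comm _ (fun y => ?_), hn, map_zero]
      rw [hA, rAX, h.Xzero (r + s) (by omega), add_zero]
    · rintro s y ⟨n, hn⟩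
      exact ⟨n + m, key _ n m s y rfl (by omega) hn⟩
  have htop := h.2.2.2.2 P hinv ⟨1, by simp [hA, h.1, hr.ne']⟩
  have : x ∈ P := htop ▸ trivial
  exact this

/-- The polynomial whose roots are the possible weights. -/
noncomputable def wp (m : ℕ) : ℂ[X] := ∏ k ∈ Finset.range (m + 1), (X - C (k : ℂ))

theorem wp_eval_zero {m : ℕ} {c : ℂ} (h : (wp m).eval c = 0) : ∃ k : ℕ, k ≤ m ∧ c = k := by
  rw [wp, eval_prod, Finset.prod_eq_zero_iff] at h
  obtain ⟨k, hk, hc⟩ := h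
  refine ⟨k, by simpa [Nat.lt_succ_iff] using hk, ?_⟩
  simpa [sub_eq_zero] using hc

theorem aeval_eig (T : Module.End ℂ W) (p : ℂ[X]) (x : W) (c : ℂ) (h : T x = c • x) :
    aeval T p x = p.eval c • x := by
  induction p using Polynomial.induction_on' with
  | add p q hp hq => simp only [map_add, LinearMap.add_apply, hp, hq, eval_add, add_smul]
  | monomial n a =>
    have : ∀ n, (T ^ n) x = c ^ n • x := by
      intro n
      induction n with
      | zero => simp
      | succ n ih => rw [pow_succ, Module.End.mul_apply, h, map_smul, ih, smul_smul, pow_succ']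
    rw [aeval_monomial, eval_monomial, Module.End.mul_apply, this,
      Module.algebraMap_end_apply, smul_smul]

theorem WV.wpD (h : WV m ρ w) : aeval (ρ.E 1 1 0) (wp m) = 0 := by
  have hinv := mon_inv (ρ := ρ) (w := w) (fun r => if r = 0 then (m : ℂ) else 0) (fun _ => 0)
    h.1 (fun r => by rw [h.2.1, zero_smul]) h.2.2.1
  have htop := h.2.2.2.2 _ hinv (Submodule.subset_span ⟨[], rfl⟩)
  have hle : Submodule.span ℂ (Set.range (ρ.mon w)) ≤
      LinearMap.ker (aeval (ρ.E 1 1 0) (wp m)) := by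
    rw [Submodule.span_le]
    rintro _ ⟨l, rfl⟩
    simp only [SetLike.mem_coe, LinearMap.mem_ker]
    by_cases hl : m < l.length
    · rw [mon_long (Finset.range m) w (fun r hr => h.2.2.2.1 r (by simpa using hr)) l
        (by simpa using hl), map_zero]
    · rw [aeval_eig _ _ _ _ (mon_weight 0 (by rw [h.2.1, zero_smul]) l)]
      have : (wp m).eval (0 + (l.length : ℂ)) = 0 := by
        rw [wp, eval_prod]
        apply Finset.prod_eq_zero (i := l.length)
        · simp; omega
        · simp
      rw [this, zero_smul]
  rw [htop, top_le_iff, LinearMap.ker_eq_top] at hle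
  exact hle

theorem exists_eig (T : Module.End ℂ M) (x : M) (hx : x ≠ 0) (n : ℕ)
    (h : aeval T (∏ k ∈ Finset.range n, (X - C (k : ℂ))) x = 0) :
    ∃ (y : M) (c : ℂ), y ≠ 0 ∧ T y = c • y := by
  induction n with
  | zero => simp at h; exact absurd h hx
  | succ n ih =>
    rw [Finset.prod_range_succ, mul_comm, map_mul, Module.End.mul_apply] at h
    by_cases h0 : aeval T (∏ k ∈ Finset.range n, (X - C (k : ℂ))) x = 0
    · exact ih h0
    · refine ⟨_, n, h0, ?_⟩
      simpa [sub_eq_zero, Nat.cast_smul_eq_nsmul] using h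

end weyl

/-- Forward direction, after shifting `b` to `0`. -/
theorem forward {m : ℕ} {ρ : CurrentRep W} {w : W} (h : WV m ρ w) {σ : CurrentRep M}
    (hirr : σ.IsIrreducible) {Q : Type} [AddCommGroup Q] [Module ℂ Q] (τ : CurrentRep Q)
    (g : Q →ₗ[ℂ] W) (hg : Function.Injective g) (hgi : Intertw τ ρ g)
    (f : Q →ₗ[ℂ] M) (hf : Function.Surjective f) (hfi : Intertw τ σ f) :
    (∀ i j r, 0 < r → σ.E i j r = 0) ∧
      ∃ l₁ l₂ : ℕ, (0 < l₁ ∨ (l₁ = 0 ∧ l₂ = 0)) ∧ l₁ + l₂ = m ∧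
        ∃ v : M, v ≠ 0 ∧ σ.E 0 1 0 v = 0 ∧
          σ.E 0 0 0 v = (l₁ : ℂ) • v ∧ σ.E 1 1 0 v = (l₂ : ℂ) • v := by
  obtain ⟨⟨x₀, hx₀⟩, hirr⟩ := hirr
  have hC : ∀ r x, σ.E 0 0 r x + σ.E 1 1 r x = (if r = 0 then (m : ℂ) else 0) • x := by
    intro r x
    obtain ⟨q, rfl⟩ := hf x
    rw [← hfi, ← hfi, ← map_add, ← map_smul]
    congr 1
    apply hg
    rw [map_add, hgi, hgi, map_smul, h.central]
  have hX : ∀ r x, 0 < r → σ.E 0 1 r x = 0 := by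
    intro r x hr
    obtain ⟨q, rfl⟩ := hf x
    rw [← hfi, ← map_zero f]
    congr 1
    apply hg
    rw [hgi, h.Xzero r hr, map_zero]
  have hYm : ∀ r x, m ≤ r → σ.E 1 0 r x = 0 := by
    intro r x hr
    obtain ⟨q, rfl⟩ := hf x
    rw [← hfi, ← map_zero f]
    congr 1
    apply hg
    rw [hgi, h.Yzero r hr, map_zero]
  have hp : ∀ x, aeval (σ.E 1 1 0) (wp m) x = 0 := by
    intro x
    obtain ⟨q, rfl⟩ := hf x
    have tr : ∀ {V : Type} [AddCommGroup V] [Module ℂ V] (θ : CurrentRep V) (k : Q →ₗ[ℂ] V)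
      (hk : Intertw τ θ k) (p : ℂ[X]), k (aeval (τ.E 1 1 0) p q) = aeval (θ.E 1 1 0) p (k q) := by
      intro V _ _ θ k hk p
      induction p using Polynomial.induction_on' with
      | add p q hp hq => simp only [map_add, LinearMap.add_apply, hp, hq]
      | monomial n a =>
        have : ∀ n, k ((τ.E 1 1 0 ^ n) q) = (θ.E 1 1 0 ^ n) (k q) := by
          intro n
          induction n with
          | zero => simp
          | succ n ih => rw [pow_succ', pow_succ', Module.End.mul_apply, hk, ih]; rfl
        simp [aeval_monomial, this]
    rw [← tr σ f hfi, ← map_zero f]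
    congr 1
    apply hg
    rw [tr ρ g hgi, h.wpD, map_zero]; rfl
  have hnil : ∀ r x, 0 < r → ∃ n, (σ.E 0 0 r ^ n) x = 0 := by
    intro r x hr
    obtain ⟨q, rfl⟩ := hf x
    have tr : ∀ {V : Type} [AddCommGroup V] [Module ℂ V] (θ : CurrentRep V) (k : Q →ₗ[ℂ] V)
      (hk : Intertw τ θ k) (n : ℕ), k ((τ.E 0 0 r ^ n) q) = (θ.E 0 0 r ^ n) (k q) := by
      intro V _ _ θ k hk n
      induction n with
      | zero => simp
      | succ n ih => rw [pow_succ', pow_succ', Module.End.mul_apply, hk, ih]; rfl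
    obtain ⟨n, hn⟩ := h.Anil r hr (g q)
    refine ⟨n, ?_⟩
    rw [← tr σ f hfi, ← map_zero f]
    congr 1
    apply hg
    rw [tr ρ g hgi, hn, map_zero]
  -- `Y r = 0` for `r ≥ 1`
  have hY : ∀ r x, 0 < r → σ.E 1 0 r x = 0 := by
    let P : Submodule ℂ M := ⨅ r : {r : ℕ // 0 < r}, LinearMap.ker (σ.E 1 0 r)
    have hmem : ∀ y, y ∈ P ↔ ∀ r, 0 < r → σ.E 1 0 r y = 0 := by
      intro y
      simp [P, Submodule.mem_iInf]
    have hinv : σ.Inv P := by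
      apply inv_of <;> intro s y hy <;> rw [hmem] at hy ⊢ <;> intro q hq
      · have := σ.rAY s q y
        rw [hy q hq, hy (s + q) (by omega), map_zero, sub_zero] at this
        exact this.symm
      · have := σ.rDY s q y
        rw [hy q hq, hy (s + q) (by omega), map_zero, add_zero] at this
        exact this.symm
      · rw [rYX, hy q hq, hC, if_neg (by omega)]; simp
      · rw [rYY, hy q hq, map_zero, neg_zero]
    have hex : ∀ j, ∃ y : M, y ≠ 0 ∧ ∀ r, m ≤ r + j → 0 < r → σ.E 1 0 r y = 0 := by
      intro j
      induction j with
      | zero => exact ⟨x₀, hx₀, fun r hr _ => hYm r _ hr⟩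
      | succ j ih =>
        obtain ⟨y, hy0, hy⟩ := ih
        by_cases hz : σ.E 1 0 (m - (j + 1)) y = 0
        · refine ⟨y, hy0, fun r hr hr0 => ?_⟩
          by_cases hr' : m ≤ r + j
          · exact hy r hr' hr0
          · rwa [show r = m - (j + 1) by omega]
        · refine ⟨_, hz, fun r hr hr0 => ?_⟩
          by_cases hr' : m ≤ r + j
          · rw [rYY, hy r hr' hr0, map_zero, neg_zero]
          · rw [show r = m - (j + 1) by omega, rYYself]
    obtain ⟨y, hy0, hy⟩ := hex m
    have hyP : y ∈ P := (hmem y).2 fun r hr => hy r (by omega) hr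
    have htop := (hirr P hinv).resolve_left (fun hb => hy0 (by simpa [hb] using hyP))
    intro r x hr
    exact (hmem x).1 (htop ▸ trivial) r hr
  have hA : ∀ r x, 0 < r → σ.E 0 0 r x = 0 := by
    intro r x hr
    let P : Submodule ℂ M := LinearMap.ker (σ.E 0 0 r)
    have hinv : σ.Inv P := by
      apply inv_of <;> intro s y hy <;> simp only [P, LinearMap.mem_ker] at hy ⊢
      · rw [rAA, hy, map_zero]
      · rw [rAD, hy, map_zero]
      · rw [rAX, hy, map_zero, hX _ _ (by omega), add_zero]
      · rw [rAY, hy, map_zero, hY _ _ (by omega), sub_zero]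
    have hne : P ≠ ⊥ := by
      intro hb
      have hinj : Function.Injective (σ.E 0 0 r) := LinearMap.ker_eq_bot.1 hb
      obtain ⟨n, hn⟩ := hnil r x₀ hr
      have : Function.Injective (σ.E 0 0 r ^ n) := by
        rw [Module.End.coe_pow]; exact hinj.iterate n
      exact hx₀ (this (by rw [hn, map_zero]))
    have htop := (hirr P hinv).resolve_left hne
    have : x ∈ P := htop ▸ trivial
    exact this
  refine ⟨?_, ?_⟩
  · intro i j r hr
    apply LinearMap.ext
    intro x
    rw [LinearMap.zero_apply]
    fin_cases i <;> fin_cases j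
    · exact hA r x hr
    · exact hX r x hr
    · exact hY r x hr
    · have := hC r x
      rw [hA r x hr, if_neg hr.ne', zero_add, zero_smul] at this
      exact this
  · have hw : ∀ (y : M) (c : ℂ), y ≠ 0 → σ.E 1 1 0 y = c • y → ∃ k : ℕ, k ≤ m ∧ c = k := by
      intro y c hy hc
      have := hp y
      rw [aeval_eig _ _ _ _ hc] at this
      exact wp_eval_zero ((smul_eq_zero.1 this).resolve_right hy)
    have hv : ∃ (v : M) (c : ℂ), v ≠ 0 ∧ σ.E 1 1 0 v = c • v ∧ σ.E 0 1 0 v = 0 := by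
      obtain ⟨y, c, hy0, hy⟩ := exists_eig (σ.E 1 1 0) x₀ hx₀ (m + 1) (hp x₀)
      by_cases hz : σ.E 0 1 0 y = 0
      · exact ⟨y, c, hy0, hy, hz⟩
      · refine ⟨_, c - 1, hz, ?_, σ.rXXself 0 y⟩
        rw [rDX, hy, map_smul, sub_smul, one_smul]
    obtain ⟨v, c, hv0, hvc, hvX⟩ := hv
    obtain ⟨k, hk, rfl⟩ := hw v c hv0 hvc
    refine ⟨m - k, k, ?_, by omega, v, hv0, hvX, ?_, hvc⟩
    · rcases Nat.eq_zero_or_pos m with rfl | hm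
      · right; omega
      · left
        have hYv : σ.E 1 0 0 v ≠ 0 := by
          intro h0
          have := σ.rXY 0 0 v
          rw [h0, hvX, map_zero, map_zero, neg_zero, zero_add, hC, if_pos rfl] at this
          rcases smul_eq_zero.1 this.symm with h1 | h1
          · have : m = 0 := by exact_mod_cast h1
            omega
          · exact hv0 h1
        obtain ⟨k', hk', he⟩ := hw _ ((k : ℂ) + 1) hYv (by
          rw [rDY, hvc, map_smul, add_smul, one_smul])
        have : k + 1 = k' := by exact_mod_cast he
        omega
    · have := hC 0 v
      rw [hvc, if_pos rfl] at this
      rw [eq_sub_of_add_eq this, ← sub_smul, Nat.cast_sub hk]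

/-- The special vectors `Y_{m-j} ⋯ Y_{m-1} w`. -/
def uvec (m : ℕ) (ρ : CurrentRep W) (w : W) : ℕ → W
  | 0 => w
  | j + 1 => ρ.E 1 0 (m - 1 - j) (uvec m ρ w j)

theorem uvec_map {m : ℕ} {ρ : CurrentRep W} {σ : CurrentRep W'} {f : W →ₗ[ℂ] W'}
    (hf : Intertw ρ σ f) (w : W) (j : ℕ) : f (uvec m ρ w j) = uvec m σ (f w) j := by
  induction j with
  | zero => rfl
  | succ j ih => simp only [uvec]; rw [hf, ih]

/-- Backward direction, after shifting `b` to `0`. -/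
theorem backward {m : ℕ} {ρ : CurrentRep W} {w : W} (h : WV m ρ w) {σ : CurrentRep M}
    (hirr : σ.IsIrreducible) (hu : ∀ k, k < m ∨ k = 0 → uvec m ρ w k ≠ 0)
    (hev : ∀ i j r, 0 < r → σ.E i j r = 0) (l₁ l₂ : ℕ) (hl : 0 < l₁ ∨ (l₁ = 0 ∧ l₂ = 0))
    (hm : l₁ + l₂ = m) (v : M) (hv0 : v ≠ 0) (hvX : σ.E 0 1 0 v = 0)
    (hvA : σ.E 0 0 0 v = (l₁ : ℂ) • v) (hvD : σ.E 1 1 0 v = (l₂ : ℂ) • v) :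
    ∃ (Q : Submodule ℂ W) (hQ : ρ.Inv Q) (f : Q →ₗ[ℂ] M), Function.Surjective f ∧
      Intertw (ρ.restr Q hQ) σ f := by
  have hkill : ∀ j, j < m ∨ j = 0 → ∀ s, m ≤ s + j → ρ.E 1 0 s (uvec m ρ w j) = 0 := by
    intro j
    induction j with
    | zero => intro _ s hs; exact h.Yzero s hs _
    | succ j ih =>
      intro hj s hs
      simp only [uvec]
      by_cases hs' : m ≤ s + j
      · rw [rYY, ih (by omega) s hs', map_zero, neg_zero]
      · rw [show s = m - 1 - j by omega, rYYself]
  have huX : ∀ j, j < m ∨ j = 0 → ∀ s, ρ.E 0 1 s (uvec m ρ w j) = 0 := by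
    intro j
    induction j with
    | zero => intro _ s; exact h.2.2.1 s
    | succ j ih =>
      intro hj s
      simp only [uvec]
      rw [rXY, ih (by omega), h.central, if_neg (by omega)]; simp
  have huD : ∀ j, j < m ∨ j = 0 → ∀ s,
      ρ.E 1 1 s (uvec m ρ w j) = (if s = 0 then (j : ℂ) else 0) • uvec m ρ w j := by
    intro j
    induction j with
    | zero => intro _ s; simpa [uvec] using h.2.1 s
    | succ j ih =>
      intro hj s
      simp only [uvec]
      rw [rDY, ih (by omega), map_smul]
      split_ifs with hs
      · subst hs
        rw [zero_add]; push_cast; module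
      · rw [hkill j (by omega) (s + (m - 1 - j)) (by omega)]; simp
  have hl2 : l₂ < m ∨ l₂ = 0 := by omega
  set u := uvec m ρ w l₂ with hu_def
  have huA : ∀ s, ρ.E 0 0 s u = (if s = 0 then (l₁ : ℂ) else 0) • u := by
    intro s
    have := h.central s u
    rw [hu_def, huD l₂ hl2 s, ← hu_def] at this
    rw [eq_sub_of_add_eq this, ← sub_smul]
    congr 1
    rw [← hm]
    split_ifs <;> simp
  let z : W × M := (u, v)
  let θ := ρ.prod σ
  let d : ℕ → ℂ := fun s => if s = 0 then (l₂ : ℂ) else 0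
  let a : ℕ → ℂ := fun s => if s = 0 then (l₁ : ℂ) else 0
  have hzA : ∀ r, θ.E 0 0 r z = a r • z := by
    intro r
    refine Prod.ext (huA r) ?_
    change σ.E 0 0 r v = a r • v
    rcases Nat.eq_zero_or_pos r with rfl | hr
    · exact hvA
    · rw [hev _ _ _ hr]; simp [a, hr.ne']
  have hzD : ∀ r, θ.E 1 1 r z = d r • z := by
    intro r
    refine Prod.ext (huD _ hl2 r) ?_
    change σ.E 1 1 r v = d r • v
    rcases Nat.eq_zero_or_pos r with rfl | hr
    · exact hvD
    · rw [hev _ _ _ hr]; simp [d, hr.ne']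
  have hzX : ∀ r, θ.E 0 1 r z = 0 := by
    intro r
    refine Prod.ext (huX _ hl2 r) ?_
    change σ.E 0 1 r v = 0
    rcases Nat.eq_zero_or_pos r with rfl | hr
    · exact hvX
    · rw [hev _ _ _ hr]; simp
  have hTinv := mon_inv a d hzA hzD hzX
  set T := Submodule.span ℂ (Set.range (θ.mon z)) with hT
  have hzT : z ∈ T := Submodule.subset_span ⟨[], rfl⟩
  -- weight `l₂` part of `T`
  have hwt : ∀ t ∈ T, θ.E 1 1 0 t = (l₂ : ℂ) • t → ∃ c : ℂ, t = c • z := by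
    intro t ht htw
    let D := θ.E 1 1 0
    have hle : T ≤ Submodule.span ℂ {z} ⊔ ⨆ μ, ⨆ (_ : μ ≠ (l₂ : ℂ)), Module.End.eigenspace D μ := by
      rw [hT, Submodule.span_le]
      rintro _ ⟨l, rfl⟩
      rcases l with _ | ⟨s, l⟩
      · exact Submodule.mem_sup_left (Submodule.mem_span_singleton_self z)
      · apply Submodule.mem_sup_right
        have hmw := mon_weight (ρ := θ) (w := z) l₂ (by simpa [d] using hzD 0) (s :: l)
        refine Submodule.mem_iSup_of_mem ((l₂ : ℂ) + (s :: l).length) ?_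
        refine Submodule.mem_iSup_of_mem ?_ (Module.End.mem_eigenspace_iff.2 hmw)
        simp only [List.length_cons, ne_eq, add_eq_left]
        exact Nat.cast_ne_zero.2 (Nat.succ_ne_zero l.length)
    obtain ⟨y, hy, t', ht', hyt⟩ := Submodule.mem_sup.1 (hle ht)
    obtain ⟨c, rfl⟩ := Submodule.mem_span_singleton.1 hy
    refine ⟨c, ?_⟩
    have h1 : t' ∈ Module.End.eigenspace D (l₂ : ℂ) := by
      have : t' = t - c • z := by rw [← hyt]; abel
      rw [this]
      refine Submodule.sub_mem _ (Module.End.mem_eigenspace_iff.2 htw)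
        (Submodule.smul_mem _ _ (Module.End.mem_eigenspace_iff.2 ?_))
      simpa [d] using hzD 0
    have h2 := (Submodule.disjoint_def.1 (Module.End.eigenspaces_iSupIndep D (l₂ : ℂ))) t' h1 ht'
    rw [← hyt, h2, add_zero]
  have hfun : ∀ t ∈ T, t.1 = 0 → t.2 = 0 := by
    have hinv : σ.Inv (T.comap (LinearMap.inr ℂ W M)) := by
      intro i j r x hx
      have := hTinv i j r _ hx
      rw [prod_E] at this
      simpa using this
    rcases hirr.2 _ hinv with hb | ht
    · rintro ⟨t1, t2⟩ ht h1
      simp only at h1 ⊢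
      subst h1
      have : t2 ∈ T.comap (LinearMap.inr ℂ W M) := ht
      rw [hb] at this
      simpa using this
    · exfalso
      have hv : v ∈ T.comap (LinearMap.inr ℂ W M) := ht ▸ trivial
      obtain ⟨c, hc⟩ := hwt _ hv (by
        refine Prod.ext ?_ ?_
        · change ρ.E 1 1 0 0 = (l₂ : ℂ) • 0
          simp
        · exact hvD)
      have h1 : (0 : W) = c • u := congrArg Prod.fst hc
      have h2 : v = c • v := congrArg Prod.snd hc
      have h3 := (smul_eq_zero.1 h1.symm).resolve_right (hu _ hl2)
      rw [h3, zero_smul] at h2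
      exact hv0 h2
  have hgraph := Submodule.mem_graph_toLinearPMap hfun
  have huniq : ∀ x y y', (x, y) ∈ T → (x, y') ∈ T → y = y' := by
    intro x y y' h1 h2
    have := hfun _ (T.sub_mem h1 h2) (by simp)
    simpa [sub_eq_zero] using this
  have hQ : ρ.Inv (T.map (LinearMap.fst ℂ W M)) := by
    rintro i j r _ ⟨t, ht, rfl⟩
    exact ⟨_, hTinv i j r t ht, rfl⟩
  refine ⟨T.map (LinearMap.fst ℂ W M), hQ, T.toLinearPMap.toFun, ?_, ?_⟩
  · have hS : σ.Inv (T.map (LinearMap.snd ℂ W M)) := by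
      rintro i j r _ ⟨t, ht, rfl⟩
      exact ⟨_, hTinv i j r t ht, rfl⟩
    have hvS : v ∈ T.map (LinearMap.snd ℂ W M) := ⟨z, hzT, rfl⟩
    have htop := (hirr.2 _ hS).resolve_left (fun hb => hv0 (by simpa [hb] using hvS))
    intro y
    obtain ⟨⟨x, y'⟩, ht, rfl⟩ : y ∈ T.map (LinearMap.snd ℂ W M) := htop ▸ trivial
    have hx : x ∈ T.map (LinearMap.fst ℂ W M) := ⟨(x, y'), ht, rfl⟩
    exact ⟨⟨x, hx⟩, huniq x _ _ (hgraph ⟨x, hx⟩) ht⟩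
  · intro i j r x
    exact huniq _ _ _ (hgraph _) (hTinv i j r _ (hgraph x))

end CurrentRep

namespace CurrentRep

open Polynomial CliffordAlgebra

/-- Build a representation from its four families of operators. -/
def mk4 {W : Type} [AddCommGroup W] [Module ℂ W] (c : ℕ → ℂ) (D X Y : ℕ → Module.End ℂ W)
    (hDD : ∀ r s x, D r (D s x) = D s (D r x))
    (hDX : ∀ r s x, D r (X s x) = X s (D r x) - X (r + s) x)
    (hDY : ∀ r s x, D r (Y s x) = Y s (D r x) + Y (r + s) x)
    (hXX : ∀ r s x, X r (X s x) = - X s (X r x))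
    (hYY : ∀ r s x, Y r (Y s x) = - Y s (Y r x))
    (hXY : ∀ r s x, X r (Y s x) = - Y s (X r x) + c (r + s) • x) : CurrentRep W where
  E i j r := ![![c r • 1 - D r, X r], ![Y r, D r]] i j
  rel i j k l r s := by
    have h4 : (-1 : ℂ) ^ 4 = 1 := by norm_num
    apply LinearMap.ext
    intro x
    fin_cases i <;> fin_cases j <;> fin_cases k <;> fin_cases l <;>
      simp [hDD r s, hDX, hDY, hXX r s, hYY r s, hXY, h4, add_comm s r] <;>
      module

section model
variable (m : ℕ)

/-- Basis vectors, zero out of range. -/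
def ev (s : ℕ) : Fin m → ℂ := fun i => if (i : ℕ) = s then 1 else 0

theorem ev_zero (s : ℕ) (h : m ≤ s) : ev m s = 0 := by
  funext i
  have : (i : ℕ) ≠ s := by omega
  simp [ev, this]

/-- Zeroth coordinate functional. -/
noncomputable def phi : Module.Dual ℂ (Fin m → ℂ) := ∑ i : Fin m, if (i : ℕ) = 0 then LinearMap.proj i else 0

/-- Fermionic Fock space. -/
abbrev Fock : Type := ExteriorAlgebra ℂ (Fin m → ℂ)

noncomputable def cr (v : Fin m → ℂ) : Module.End ℂ (Fock m) :=
  LinearMap.mulLeft ℂ (ExteriorAlgebra.ι ℂ v)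

noncomputable def an (d : Module.Dual ℂ (Fin m → ℂ)) : Module.End ℂ (Fock m) :=
  contractLeft (Q := (0 : QuadraticForm ℂ (Fin m → ℂ))) d

theorem cr_cr (v v' : Fin m → ℂ) (x : Fock m) : cr m v (cr m v' x) = - cr m v' (cr m v x) := by
  simp only [cr, LinearMap.mulLeft_apply, ← mul_assoc]
  rw [eq_neg_iff_add_eq_zero, ← add_mul, ExteriorAlgebra.ι_add_mul_swap, zero_mul]

theorem an_cr (d : Module.Dual ℂ (Fin m → ℂ)) (v : Fin m → ℂ) (x : Fock m) :
    an m d (cr m v x) = d v • x - cr m v (an m d x) :=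
  contractLeft_ι_mul (Q := (0 : QuadraticForm ℂ (Fin m → ℂ))) d v x

theorem an_an (d d' : Module.Dual ℂ (Fin m → ℂ)) (x : Fock m) :
    an m d (an m d' x) = - an m d' (an m d x) :=
  contractLeft_comm (Q := (0 : QuadraticForm ℂ (Fin m → ℂ))) d d' x

theorem an_one (d : Module.Dual ℂ (Fin m → ℂ)) : an m d (1 : Fock m) = 0 :=
  contractLeft_one (Q := (0 : QuadraticForm ℂ (Fin m → ℂ))) d

theorem fock_ext (S T : Module.End ℂ (Fock m)) (h1 : S 1 = T 1)
    (h : ∀ v x, S x = T x → S (cr m v x) = T (cr m v x)) (x : Fock m) : S x = T x := by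
  refine CliffordAlgebra.left_induction (Q := (0 : QuadraticForm ℂ (Fin m → ℂ)))
    (P := fun x => S x = T x) ?_ ?_ ?_ x
  · intro r
    rw [Algebra.algebraMap_eq_smul_one, map_smul, map_smul]
    exact congrArg (r • ·) h1
  · intro x y hx hy
    rw [map_add, map_add, hx, hy]
  · intro x v hx
    exact h v x hx

/-- Shift on `ℂ^m`. -/
def sh (r : ℕ) (v : Fin m → ℂ) : Fin m → ℂ := ∑ i : Fin m, v i • ev m (i + r)

theorem sh_ev (r s : ℕ) : sh m r (ev m s) = ev m (r + s) := by
  unfold sh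
  by_cases hs : s < m
  · rw [Finset.sum_eq_single ⟨s, hs⟩]
    · simp [ev, add_comm r s]
    · intro i _ hi
      have : (i : ℕ) ≠ s := fun h => hi (Fin.ext h)
      simp [ev, this]
    · simp
  · rw [ev_zero m (r + s) (by omega), ev_zero m s (by omega)]
    simp

theorem sh_sh (r s : ℕ) (v : Fin m → ℂ) : sh m r (sh m s v) = ∑ i : Fin m, v i • ev m (r + s + i) := by
  have hlin : ∀ v, sh m r v = (∑ i : Fin m, (LinearMap.proj i : (Fin m → ℂ) →ₗ[ℂ] ℂ).smulRight (ev m (i + r))) v := by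
    intro v; simp [sh, LinearMap.sum_apply]
  rw [hlin, sh, map_sum]
  refine Finset.sum_congr rfl fun i _ => ?_
  rw [map_smul, ← hlin, sh_ev]
  congr 2
  ring

noncomputable def dD (r : ℕ) : Module.End ℂ (Fock m) :=
  ∑ i : Fin m, cr m (ev m (i + r)) * an m (LinearMap.proj i)

theorem cr_add (v v' : Fin m → ℂ) : cr m (v + v') = cr m v + cr m v' := by
  ext x; simp [cr, add_mul]
theorem cr_smul (a : ℂ) (v : Fin m → ℂ) : cr m (a • v) = a • cr m v := by
  ext x; simp [cr]
theorem cr_zero : cr m 0 = 0 := by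
  ext x; simp [cr]
theorem cr_sum {ι : Type} (s : Finset ι) (f : ι → Fin m → ℂ) :
    cr m (∑ i ∈ s, f i) = ∑ i ∈ s, cr m (f i) := by
  classical
  induction s using Finset.induction_on with
  | empty => simp [cr_zero]
  | insert a s ha ih => rw [Finset.sum_insert ha, Finset.sum_insert ha, cr_add, ih]

theorem dD_cr (r : ℕ) (v : Fin m → ℂ) (x : Fock m) :
    dD m r (cr m v x) = cr m v (dD m r x) + cr m (sh m r v) x := by
  simp only [dD, sh, cr_sum, LinearMap.sum_apply, Module.End.mul_apply, map_sum,
    ← Finset.sum_add_distrib]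
  refine Finset.sum_congr rfl fun i _ => ?_
  rw [an_cr, map_sub, cr_cr m _ v, cr_smul, map_smul]
  simp only [LinearMap.proj_apply, LinearMap.smul_apply]
  abel

theorem dD_one (r : ℕ) : dD m r (1 : Fock m) = 0 := by
  simp [dD, LinearMap.sum_apply, an_one]

theorem dD_comm (r s : ℕ) (x : Fock m) : dD m r (dD m s x) = dD m s (dD m r x) := by
  refine fock_ext m (dD m r * dD m s) (dD m s * dD m r) ?_ ?_ x
  · simp [dD_one]
  · intro v x hx
    simp only [Module.End.mul_apply] at hx ⊢
    simp only [dD_cr, map_add, hx, sh_sh, add_comm s r]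
    abel

theorem phi_ev (s : ℕ) : phi m (ev m s) = if s = 0 ∧ 0 < m then 1 else 0 := by
  unfold phi
  rw [LinearMap.sum_apply]
  by_cases hm : 0 < m
  · rw [Finset.sum_eq_single ⟨0, hm⟩]
    · simp [ev, hm, eq_comm]
    · intro i _ hi
      have : (i : ℕ) ≠ 0 := fun h => hi (Fin.ext h)
      simp [this]
    · simp
  · have : m = 0 := by omega
    subst this
    simp

theorem an_sum {ι : Type} (s : Finset ι) (f : ι → Module.Dual ℂ (Fin m → ℂ)) :
    an m (∑ i ∈ s, f i) = ∑ i ∈ s, an m (f i) := by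
  simp [an]

theorem dD_an (r : ℕ) (x : Fock m) :
    dD m r (an m (phi m) x) = an m (phi m) (dD m r x) - if r = 0 then an m (phi m) x else 0 := by
  have key : (if r = 0 then an m (phi m) x else 0)
      = ∑ i : Fin m, phi m (ev m (i + r)) • an m (LinearMap.proj i) x := by
    split_ifs with hr
    · subst hr
      conv_lhs => rw [phi, an_sum, LinearMap.sum_apply]
      refine Finset.sum_congr rfl fun i _ => ?_
      have hm : 0 < m := by have := i.2; omega
      rw [phi_ev]
      by_cases hi : (i : ℕ) = 0
      · simp [hi, hm]
      · simp [hi, an]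
    · symm
      apply Finset.sum_eq_zero
      intro i _
      rw [phi_ev, if_neg (by omega), zero_smul]
  rw [key]
  simp only [dD, LinearMap.sum_apply, Module.End.mul_apply, map_sum, ← Finset.sum_sub_distrib]
  refine Finset.sum_congr rfl fun i _ => ?_
  rw [an_cr, an_an m _ (phi m), map_neg]
  abel

/-- The Fock space model (parameter `0`). -/
noncomputable def fock : CurrentRep (Fock m) :=
  mk4 (fun r => if r = 0 then (m : ℂ) else 0) (dD m)
    (fun r => if r = 0 then (m : ℂ) • an m (phi m) else 0) (fun r => cr m (ev m r))
    (dD_comm m)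
    (by
      intro r s x
      by_cases hs : s = 0
      · subst hs
        by_cases hr : r = 0
        · simp [hr, dD_an, smul_sub]
        · simp [hr, dD_an]
      · have : ¬ (r + s = 0) := by omega
        simp [hs])
    (by
      intro r s x
      simp only [dD_cr, sh_ev])
    (by
      intro r s x
      by_cases hs : s = 0 <;> by_cases hr : r = 0 <;> simp [hs, hr]
      rw [← smul_neg, ← smul_neg, ← an_an])
    (by
      intro r s x
      exact cr_cr m _ _ x)
    (by
      intro r s x
      by_cases hr : r = 0
      · subst hr
        simp only [if_true, LinearMap.smul_apply, an_cr, phi_ev, zero_add, map_smul]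
        by_cases hs : s = 0
        · by_cases hm : 0 < m
          · simp [hs, hm, smul_sub]; abel
          · have : m = 0 := by omega
            simp [this]
        · simp [hs]
      · simp [hr])

theorem uvec_fock (k : ℕ) (hk : k < m ∨ k = 0) : uvec m (fock m) (1 : Fock m) k ≠ 0 := by
  have hkill : ∀ j, j < m ∨ j = 0 → ∀ i : Fin m, (i : ℕ) + j < m →
      an m (LinearMap.proj i) (uvec m (fock m) 1 j) = 0 := by
    intro j
    induction j with
    | zero => intro _ i _; exact an_one m _
    | succ j ih =>
      intro hj i hi
      change an m (LinearMap.proj i) (cr m (ev m (m - 1 - j)) _) = 0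
      have : ¬ ((i : ℕ) = m - 1 - j) := by omega
      rw [an_cr, ih (by omega) i (by omega)]
      simp [ev, this]
  induction k with
  | zero => exact one_ne_zero
  | succ k ih =>
    intro h0
    apply ih (by omega)
    have h1 : an m (LinearMap.proj ⟨m - 1 - k, by omega⟩)
        (cr m (ev m (m - 1 - k)) (uvec m (fock m) 1 k)) = 0 := by
      change cr m (ev m (m - 1 - k)) (uvec m (fock m) 1 k) = 0 at h0
      rw [h0, map_zero]
    rw [an_cr, hkill k (by omega) _ (by simp only; omega)] at h1
    simpa [ev] using h1

end model

/-- Submodule generated by a vector. -/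
def gen {W : Type} [AddCommGroup W] [Module ℂ W] (ρ : CurrentRep W) (w : W) : Submodule ℂ W :=
  sInf {P | ρ.Inv P ∧ w ∈ P}

theorem gen_inv {W : Type} [AddCommGroup W] [Module ℂ W] (ρ : CurrentRep W) (w : W) :
    ρ.Inv (ρ.gen w) := by
  intro i j r x hx
  simp only [gen, Submodule.mem_sInf, Set.mem_ofPred_eq] at hx ⊢
  exact fun P hP => hP.1 i j r x (hx P hP)

theorem mem_gen {W : Type} [AddCommGroup W] [Module ℂ W] (ρ : CurrentRep W) (w : W) :
    w ∈ ρ.gen w := by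
  simp only [gen, Submodule.mem_sInf, Set.mem_ofPred_eq]
  exact fun P hP => hP.2

theorem gen_cyclic {W : Type} [AddCommGroup W] [Module ℂ W] (ρ : CurrentRep W) (w : W) :
    (ρ.restr (ρ.gen w) (ρ.gen_inv w)).IsCyclic ⟨w, ρ.mem_gen w⟩ := by
  intro P hP hw
  have hle : ρ.gen w ≤ P.map (ρ.gen w).subtype := by
    apply sInf_le
    refine ⟨?_, ⟨_, hw, rfl⟩⟩
    rintro i j r _ ⟨x, hx, rfl⟩
    exact ⟨_, hP i j r x hx, rfl⟩
  rw [eq_top_iff]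
  rintro ⟨x, hx⟩ _
  obtain ⟨y, hy, he⟩ := hle hx
  have : y = ⟨x, hx⟩ := Subtype.ext he
  rwa [this] at hy

theorem exists_model (m : ℕ) : ∃ (V : Type) (_ : AddCommGroup V) (_ : Module ℂ V)
    (σ : CurrentRep V) (v : V), WV m σ v ∧ ∀ k, k < m ∨ k = 0 → uvec m σ v k ≠ 0 := by
  refine ⟨(fock m).gen 1, inferInstance, inferInstance, (fock m).restr _ ((fock m).gen_inv 1),
    ⟨1, (fock m).mem_gen 1⟩, ⟨?_, ?_, ?_, ?_, gen_cyclic _ _⟩, ?_⟩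
  · intro r
    apply Subtype.ext
    change (fock m).E 0 0 r 1 = (if r = 0 then (m : ℂ) else 0) • (1 : Fock m)
    by_cases hr : r = 0 <;> simp [fock, mk4, dD_one, hr]
  · intro r
    apply Subtype.ext
    change (fock m).E 1 1 r 1 = 0
    simp [fock, mk4, dD_one]
  · intro r
    apply Subtype.ext
    change (fock m).E 0 1 r 1 = 0
    by_cases hr : r = 0 <;> simp [fock, mk4, hr, an_one]
  · intro r hr
    apply Subtype.ext
    change (fock m).E 1 0 r 1 = 0
    simp [fock, mk4, ev_zero m r hr, cr_zero]
  · intro k hk h0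
    apply uvec_fock m k hk
    have := uvec_map (m := m) (restr_intertw (fock m) _ ((fock m).gen_inv 1))
      ⟨1, (fock m).mem_gen 1⟩ k
    rw [h0, map_zero] at this
    exact this.symm

variable {W : Type} [AddCommGroup W] [Module ℂ W]

theorem Ep_eig {ρ : CurrentRep W} {w : W} {i j : Fin 2} (a c : ℂ)
    (h : ∀ r, ρ.E i j r w = (a * c ^ r) • w) (p : ℂ[X]) : ρ.Ep i j p w = (a * p.eval c) • w := by
  induction p using Polynomial.induction_on' with
  | add p q hp hq => simp only [map_add, LinearMap.add_apply, hp, hq, eval_add]; module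
  | monomial n z =>
    rw [Ep_monomial, LinearMap.smul_apply, h, eval_monomial, smul_smul]
    congr 1
    ring

theorem Ep_sum (ρ : CurrentRep W) (i j : Fin 2) (p : ℂ[X]) (n : ℕ) (hn : p.natDegree < n) :
    ρ.Ep i j p = ∑ k ∈ Finset.range n, p.coeff k • ρ.E i j k := by
  conv_lhs => rw [p.as_sum_range' n hn, map_sum]
  exact Finset.sum_congr rfl fun k _ => by rw [Ep_monomial]

theorem Ep_weyl (ρ : CurrentRep W) (m : ℕ) (b : ℂ) (w : W) :
    ∑ i ∈ Finset.range (m + 1),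
      (((Polynomial.X - Polynomial.C b) ^ m : Polynomial ℂ).coeff i) • ρ.E 1 0 i w =
    (ρ.shift b).E 1 0 m w := by
  rw [shift_E, Ep_sum _ _ _ _ (m + 1) (by
    rw [natDegree_pow, natDegree_X_sub_C]; omega), LinearMap.sum_apply]
  rfl

theorem WV_of_weyl {m : ℕ} {b : ℂ} {ρ : CurrentRep W} {w : W} (h : IsWeylVecSingle m b ρ w) :
    WV m (ρ.shift b) w := by
  obtain ⟨hA, hD, hX, hY, hc⟩ := h
  have hA' : ∀ r : ℕ, (ρ.shift b).E 0 0 r w = (if r = 0 then (m : ℂ) else 0) • w := by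
    intro r
    rw [shift_E, Ep_eig _ _ hA]
    by_cases hr : r = 0 <;> simp [hr]
  refine ⟨hA', ?_, ?_, ?_, hc.shift b⟩
  · intro r
    rw [shift_E, Ep_eig 0 0 (by simpa using hD)]; simp
  · intro r
    rw [shift_E, Ep_eig 0 0 (by simpa using hX)]; simp
  · intro r hr
    rw [Ep_weyl] at hY
    have := (ρ.shift b).rAY (r - m) m w
    rw [hY, hA', map_zero, map_smul, hY, smul_zero, zero_sub, Nat.sub_add_cancel hr] at this
    exact neg_eq_zero.1 this.symm

theorem weyl_of_WV {m : ℕ} {b : ℂ} {ρ : CurrentRep W} {w : W} (h : WV m ρ w) :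
    IsWeylVecSingle m b (ρ.shift (-b)) w := by
  obtain ⟨hA, hD, hX, hY, hc⟩ := h
  refine ⟨?_, ?_, ?_, ?_, hc.shift _⟩
  · intro r
    rw [shift_E, Ep_eig (m : ℂ) 0 (by
      intro r; rw [hA]; by_cases hr : r = 0 <;> simp [hr])]
    simp
  · intro r
    rw [shift_E, Ep_eig 0 0 (by simpa using hD)]; simp
  · intro r
    rw [shift_E, Ep_eig 0 0 (by simpa using hX)]; simp
  · rw [Ep_weyl, shift_shift']
    exact hY m le_rfl

end CurrentRep

/-- An irreducible `gl(1|1)[t]`-module `M` is a subquotient of the Weyl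
module `W_m(b)` if and only if `M` has the form `L_λ(b)`: `M` is an evaluation module at `b`
with a highest weight vector of polynomial weight `λ = (λ₁, λ₂)`, `λ₁ + λ₂ = m`. -/
theorem weyl_module_irreducible_subquotients
    (m : ℕ) (b : ℂ)
    (W : Type) [AddCommGroup W] [Module ℂ W] (ρ : CurrentRep W) (w : W)
    (hW : IsWeylModuleSingle m b W ρ w)
    (M : Type) [AddCommGroup M] [Module ℂ M] (ρM : CurrentRep M)
    (hirr : ρM.IsIrreducible) :
    (∃ (Q : Submodule ℂ W)
       (hQ : ∀ (i j : Fin 2) (r : ℕ) (x : W), x ∈ Q → ρ.E i j r x ∈ Q)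
       (f : Q →ₗ[ℂ] M),
        Function.Surjective f ∧
        ∀ (i j : Fin 2) (r : ℕ) (x : W) (hx : x ∈ Q),
          f ⟨ρ.E i j r x, hQ i j r x hx⟩ = ρM.E i j r (f ⟨x, hx⟩)) ↔
    (ρM.IsEvaluationAt b ∧
      ∃ l₁ l₂ : ℕ, (0 < l₁ ∨ (l₁ = 0 ∧ l₂ = 0)) ∧ l₁ + l₂ = m ∧
        ∃ v : M, v ≠ 0 ∧ ρM.E 0 1 0 v = 0 ∧
          ρM.E 0 0 0 v = (l₁ : ℂ) • v ∧ ρM.E 1 1 0 v = (l₂ : ℂ) • v) := by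
  classical
  have h := CurrentRep.WV_of_weyl hW.1
  have hirr' := hirr.shift b
  constructor
  · rintro ⟨Q, hQ, f, hf, hfi⟩
    have hfi' : CurrentRep.Intertw (ρ.restr Q hQ) ρM f := fun i j r x => hfi i j r x.1 x.2
    obtain ⟨h1, l₁, l₂, hl, hm, v, hv0, hvX, hvA, hvD⟩ :=
      CurrentRep.forward h hirr' ((ρ.restr Q hQ).shift b) Q.subtype
        Q.injective_subtype ((ρ.restr_intertw Q hQ).shift b) f hf (hfi'.shift b)
    rw [CurrentRep.shift_zero_E] at hvX hvA hvD
    exact ⟨CurrentRep.eval_of_shift ρM b h1, l₁, l₂, hl, hm, v, hv0, hvX, hvA, hvD⟩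
  · rintro ⟨hev, l₁, l₂, hl, hm, v, hv0, hvX, hvA, hvD⟩
    have hu : ∀ k, k < m ∨ k = 0 → CurrentRep.uvec m (ρ.shift b) w k ≠ 0 := by
      intro k hk h0
      obtain ⟨V, _, _, σ, v', hσ, hne⟩ := CurrentRep.exists_model m
      obtain ⟨g, hgw, hg⟩ := hW.2 V (σ.shift (-b)) v' (CurrentRep.weyl_of_WV hσ)
      have hg' : CurrentRep.Intertw ρ (σ.shift (-b)) g := hg
      have hg2 := hg'.shift b
      rw [CurrentRep.shift_shift'] at hg2
      apply hne k hk
      rw [← hgw, ← CurrentRep.uvec_map hg2, h0, map_zero]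
    rw [← CurrentRep.shift_zero_E ρM b] at hvX hvA hvD
    obtain ⟨Q, hQ, f, hf, hfi⟩ := CurrentRep.backward h hirr' hu
      (CurrentRep.shift_of_eval ρM b hev) l₁ l₂ hl hm v hv0 hvX hvA hvD
    have hQ' : ρ.Inv Q := CurrentRep.Inv.of_shift hQ
    refine ⟨Q, hQ', f, hf, ?_⟩
    have h1 := hfi.shift (-b)
    have h2 := (CurrentRep.restr_intertw (ρ.shift b) Q hQ).shift (-b)
    rw [CurrentRep.shift_shift] at h1 h2
    intro i j r x hx
    rw [← h1 i j r ⟨x, hx⟩]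
    congr 1
    apply Subtype.ext
    exact (h2 i j r ⟨x, hx⟩).symm
end

section
/- The quotient algebra C[w_1,...,w_{k−1}]^{S_l × S_{k−l−1}} / ⟨σ_1(w) − ε_1, ..., σ_{k−1}(w) − ε_{k−1}⟩ has dimension binomial(k−1, l) over C for any complex numbers ε_1, ..., ε_{k−1}, and is a Frobenius algebra. -/
set_option synthInstance.maxHeartbeats 1000000
set_option maxHeartbeats 1000000

open MvPolynomial

/-- The subalgebra of polynomials invariant under a subgroup of permutations of variables. -/
noncomputable def invariantSubalgebra (n : ℕ) (G : Subgroup (Equiv.Perm (Fin n))) :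
    Subalgebra ℂ (MvPolynomial (Fin n) ℂ) where
  carrier := {p | ∀ σ ∈ G, rename (σ : Equiv.Perm (Fin n)) p = p}
  algebraMap_mem' r := fun σ _ => rename_C σ r
  mul_mem' ha hb := fun σ hσ => by rw [map_mul, ha σ hσ, hb σ hσ]
  add_mem' ha hb := fun σ hσ => by rw [map_add, ha σ hσ, hb σ hσ]

/-- The subgroup `S_l × S_{m-l}` of `S_m`. -/
def parabolicSubgroup (m l : ℕ) : Subgroup (Equiv.Perm (Fin m)) where
  carrier := {σ | ∀ i : Fin m, (σ i : ℕ) < l ↔ (i : ℕ) < l}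
  one_mem' := by intro i; simp
  mul_mem' := by
    intro σ τ hσ hτ i
    simpa [Equiv.Perm.mul_apply] using (hσ (τ i)).trans (hτ i)
  inv_mem' := by
    intro σ hσ i
    simpa using (hσ (σ⁻¹ i)).symm

/-- The element `σ_{i+1}(w) − ε_{i+1}` of `ℂ[w₁,...,w_{k−1}]^{S_l × S_{k−1−l}}`. -/
noncomputable def sigmaMinusEps (k l : ℕ) (ε : Fin (k - 1) → ℂ) (i : Fin (k - 1)) :
    invariantSubalgebra (k - 1) (parabolicSubgroup (k - 1) l) :=
  ⟨esymm (Fin (k - 1)) ℂ ((i : ℕ) + 1) - MvPolynomial.C (ε i), by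
    refine Subalgebra.sub_mem _ (fun σ _ => esymm_isSymmetric (Fin (k - 1)) ℂ ((i : ℕ) + 1) σ)
      (fun σ _ => rename_C σ (ε i))⟩

section aux

open Finset

/-- Substitution `X_j ↦ X_i`. -/
noncomputable def substVar {n : ℕ} (i j : Fin n) :
    MvPolynomial (Fin n) ℂ →ₐ[ℂ] MvPolynomial (Fin n) ℂ :=
  aeval (fun k => if k = j then X i else X k)

lemma dvd_iff_substVar {n : ℕ} (i j : Fin n) (g : MvPolynomial (Fin n) ℂ) :
    (X j - X i) ∣ g ↔ substVar i j g = 0 := by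
  constructor
  · rintro ⟨h, rfl⟩
    rw [map_mul]
    have : substVar i j (X j - X i) = 0 := by
      simp [substVar]
    rw [this, zero_mul]
  · intro h
    rw [← Ideal.mem_span_singleton, ← Ideal.Quotient.eq_zero_iff_mem]
    set I := Ideal.span {(X j - X i : MvPolynomial (Fin n) ℂ)}
    have key : (Ideal.Quotient.mkₐ ℂ I).comp (substVar i j) = Ideal.Quotient.mkₐ ℂ I := by
      ext k
      simp only [substVar, AlgHom.comp_apply, aeval_X]
      split_ifs with hk
      · subst hk
        rw [Ideal.Quotient.mkₐ_eq_mk]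
        symm
        rw [Ideal.Quotient.eq]
        exact Ideal.mem_span_singleton_self _
      · rfl
    have := DFunLike.congr_fun key g
    rw [AlgHom.comp_apply, h, map_zero] at this
    exact this.symm

lemma prime_X_sub_X {n : ℕ} {i j : Fin n} (h : i ≠ j) :
    Prime (X j - X i : MvPolynomial (Fin n) ℂ) := by
  refine ⟨?_, ?_, ?_⟩
  · rw [sub_ne_zero]
    exact fun h' => h (X_injective h').symm
  · intro hu
    have := (dvd_iff_substVar i j 1).1 hu.dvd
    simp at this
  · intro a b hab
    rw [dvd_iff_substVar, map_mul] at hab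
    simpa [dvd_iff_substVar] using hab

lemma isRelPrime_X_sub_X {n : ℕ} {i j a b : Fin n} (h : i < j) (h' : a < b)
    (hne : (i, j) ≠ (a, b)) :
    IsRelPrime (X j - X i : MvPolynomial (Fin n) ℂ) (X b - X a) := by
  rw [(prime_X_sub_X h.ne).irreducible.isRelPrime_iff_not_dvd, dvd_iff_substVar]
  simp only [substVar, map_sub, aeval_X]
  rw [sub_eq_zero]
  intro hh
  have hinj : Function.Injective (X : Fin n → MvPolynomial (Fin n) ℂ) := X_injective
  split_ifs at hh with h1 h2 h2 <;> have := hinj hh <;> grind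

/-- ordered pairs. -/
def pairs (n : ℕ) : Finset (Fin n × Fin n) := univ.filter (fun p => p.1 < p.2)

/-- The Vandermonde product. -/
noncomputable def vand (n : ℕ) : MvPolynomial (Fin n) ℂ := ∏ p ∈ pairs n, (X p.2 - X p.1)

lemma vand_eq (n : ℕ) :
    vand n = (Matrix.vandermonde (X : Fin n → MvPolynomial (Fin n) ℂ)).det := by
  rw [Matrix.det_vandermonde, Finset.prod_sigma', vand]
  refine Finset.prod_bij' (fun p _ => ⟨p.1, p.2⟩) (fun p _ => (p.1, p.2)) ?_ ?_ ?_ ?_ ?_ <;>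
    simp [pairs]

lemma vand_ne_zero (n : ℕ) : vand n ≠ 0 := by
  rw [vand, Finset.prod_ne_zero_iff]
  intro p hp
  exact (prime_X_sub_X (by simp [pairs] at hp; exact hp.ne)).ne_zero

/-- sign of a permutation as a polynomial. -/
noncomputable def sg {n : ℕ} (σ : Equiv.Perm (Fin n)) : MvPolynomial (Fin n) ℂ :=
  ((Equiv.Perm.sign σ : ℤ) : MvPolynomial (Fin n) ℂ)

lemma sg_mul {n : ℕ} (σ τ : Equiv.Perm (Fin n)) : sg (σ * τ) = sg σ * sg τ := by
  simp [sg]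

lemma sg_mul_self {n : ℕ} (σ : Equiv.Perm (Fin n)) : sg σ * sg σ = 1 := by
  simp only [sg]
  rw [← Int.cast_mul, Int.units_coe_mul_self]
  simp

lemma rename_sg {n : ℕ} (σ τ : Equiv.Perm (Fin n)) : rename σ (sg τ) = sg τ := by
  simp [sg]

lemma rename_vand {n : ℕ} (σ : Equiv.Perm (Fin n)) :
    rename σ (vand n) = sg σ * vand n := by
  rw [vand_eq, AlgHom.map_det]
  have : (rename σ : MvPolynomial (Fin n) ℂ →ₐ[ℂ] _).mapMatrix
      (Matrix.vandermonde (X : Fin n → MvPolynomial (Fin n) ℂ)) =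
      (Matrix.vandermonde (X : Fin n → MvPolynomial (Fin n) ℂ)).submatrix σ id := by
    ext1 a b
    simp [Matrix.vandermonde_apply]
  rw [this, Matrix.det_permute, sg]

lemma rename_mul_perm {n : ℕ} (σ τ : Equiv.Perm (Fin n)) (f : MvPolynomial (Fin n) ℂ) :
    rename (σ * τ : Equiv.Perm (Fin n)) f = rename σ (rename τ f) := by
  rw [rename_rename]; rfl

lemma vand_dvd {n : ℕ} (g : MvPolynomial (Fin n) ℂ)
    (hg : ∀ σ : Equiv.Perm (Fin n), rename σ g = sg σ * g) : vand n ∣ g := by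
  apply Finset.prod_dvd_of_isRelPrime
  · rintro ⟨i, j⟩ hp ⟨a, b⟩ hq hne
    simp [pairs] at hp hq
    exact isRelPrime_X_sub_X hp hq hne
  · rintro ⟨i, j⟩ hp
    simp [pairs] at hp
    rw [dvd_iff_substVar]
    have h1 := hg (Equiv.swap i j)
    have h2 : sg (Equiv.swap i j) = -1 := by simp [sg, Equiv.Perm.sign_swap hp.ne]
    have h3 : substVar i j (rename (Equiv.swap i j) g) = substVar i j g := by
      have : (substVar i j).comp (rename (Equiv.swap i j)) = substVar i j := by
        ext1 k
        simp only [substVar, AlgHom.comp_apply, rename_X, aeval_X]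
        rcases eq_or_ne k i with rfl | h1
        · simp
        · rcases eq_or_ne k j with rfl | h2
          · simp
          · rw [Equiv.swap_apply_of_ne_of_ne h1 h2]
      exact DFunLike.congr_fun this g
    rw [h1, h2] at h3
    simp only [map_mul, map_neg, map_one] at h3
    have : (2 : MvPolynomial (Fin n) ℂ) * substVar i j g = 0 := by linear_combination -h3
    simpa using this

/-- antisymmetrization. -/
noncomputable def alt {n : ℕ} (f : MvPolynomial (Fin n) ℂ) : MvPolynomial (Fin n) ℂ :=
  ∑ σ : Equiv.Perm (Fin n), sg σ * rename σ f

lemma rename_alt {n : ℕ} (τ : Equiv.Perm (Fin n)) (f : MvPolynomial (Fin n) ℂ) :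
    rename τ (alt f) = sg τ * alt f := by
  rw [alt, map_sum, Finset.mul_sum]
  refine Fintype.sum_equiv (Equiv.mulLeft τ) _ _ (fun σ => ?_)
  simp only [map_mul, rename_sg, Equiv.coe_mulLeft]
  rw [rename_mul_perm, sg_mul, ← mul_assoc, ← mul_assoc, sg_mul_self, one_mul]

lemma exists_div (n : ℕ) : ∃ D : MvPolynomial (Fin n) ℂ →ₗ[ℂ] MvPolynomial (Fin n) ℂ,
    (∀ f, vand n * D f = alt f) ∧ (∀ f, (D f).IsSymmetric) ∧
    ∀ r f, r.IsSymmetric → D (r * f) = r * D f := by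
  choose D hD using fun f => vand_dvd (alt f) (fun σ => rename_alt σ f)
  have hv := vand_ne_zero n
  refine ⟨⟨⟨D, ?_⟩, ?_⟩, fun f => (hD f).symm, ?_, ?_⟩
  · intro f g
    apply mul_left_cancel₀ hv
    rw [mul_add, ← hD, ← hD, ← hD]
    simp [alt, mul_add, Finset.sum_add_distrib]
  · intro c f
    apply mul_left_cancel₀ hv
    simp only [RingHom.id_apply, mul_smul_comm]
    rw [← hD, ← hD]
    simp [alt, Finset.smul_sum]
  · intro f σ
    apply mul_left_cancel₀ hv
    have h1 := rename_alt σ f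
    rw [hD f, map_mul, rename_vand] at h1
    have h2 : (sg σ * sg σ) * (vand n * rename σ (D f)) =
      (sg σ * sg σ) * (vand n * D f) := by linear_combination sg σ * h1
    rw [sg_mul_self] at h2
    simpa using h2
  · intro r f hr
    apply mul_left_cancel₀ hv
    simp only [LinearMap.coe_mk, AddHom.coe_mk]
    rw [← hD, mul_left_comm, ← hD]
    simp only [alt, Finset.mul_sum, map_mul]
    refine Finset.sum_congr rfl (fun σ _ => ?_)
    rw [hr σ]; ring

end aux
section aux2

open Finset TensorProduct

/-- Pairs crossing between the two blocks. -/
def cross (n l : ℕ) : Finset (Fin n × Fin n) :=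
  univ.filter (fun p => (p.1 : ℕ) < l ∧ ¬ (p.2 : ℕ) < l)

/-- Product over crossing pairs. -/
noncomputable def crossProd (n l : ℕ) : MvPolynomial (Fin n) ℂ :=
  ∏ p ∈ cross n l, (X p.2 - X p.1)

/-- Vandermonde of the parabolic subgroup. -/
noncomputable def parVand (n l : ℕ) : MvPolynomial (Fin n) ℂ :=
  ∏ p ∈ pairs n \ cross n l, (X p.2 - X p.1)

lemma parVand_mul (n l : ℕ) : parVand n l * crossProd n l = vand n := by
  apply Finset.prod_sdiff
  intro p
  simp only [cross, pairs, mem_filter, mem_univ, true_and, Fin.lt_def]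
  omega

lemma crossProd_ne_zero (n l : ℕ) : crossProd n l ≠ 0 := by
  intro h
  have := parVand_mul n l
  rw [h, mul_zero] at this
  exact vand_ne_zero n this.symm

lemma prod_cross_perm {n l : ℕ} {M : Type*} [CommMonoid M] (F : Fin n → Fin n → M)
    {π σ : Equiv.Perm (Fin n)} (hπ : π ∈ parabolicSubgroup n l)
    (hσ : σ ∈ parabolicSubgroup n l) :
    ∏ p ∈ cross n l, F (π p.1) (σ p.2) = ∏ p ∈ cross n l, F p.1 p.2 := by
  refine Finset.prod_equiv (Equiv.prodCongr π σ) ?_ ?_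
  · rintro ⟨i, j⟩
    have h1 := hπ i
    have h2 := hσ j
    simp only [cross, mem_filter, mem_univ, true_and, Equiv.prodCongr_apply, Prod.map]
    rw [h1, h2]
  · rintro ⟨i, j⟩ _
    rfl

lemma prod_cross_one {n l : ℕ} {σ : Equiv.Perm (Fin n)} (hσ : σ ∈ parabolicSubgroup n l) :
    ∏ p ∈ cross n l, (X (σ p.2) - X p.1 : MvPolynomial (Fin n) ℂ) = crossProd n l := by
  have h := prod_cross_perm (fun i j => (X j - X i : MvPolynomial (Fin n) ℂ))
    (one_mem (parabolicSubgroup n l)) hσ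
  simpa only [Equiv.Perm.coe_one, id, crossProd] using h

lemma rename_crossProd {n l : ℕ} {σ : Equiv.Perm (Fin n)} (hσ : σ ∈ parabolicSubgroup n l) :
    rename σ (crossProd n l) = crossProd n l := by
  simp only [crossProd, map_prod, map_sub, rename_X]
  exact prod_cross_perm (fun i j => (X j - X i : MvPolynomial (Fin n) ℂ)) hσ hσ

lemma rename_parVand {n l : ℕ} {σ : Equiv.Perm (Fin n)} (hσ : σ ∈ parabolicSubgroup n l) :
    rename σ (parVand n l) = sg σ * parVand n l := by
  apply mul_right_cancel₀ (crossProd_ne_zero n l)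
  have h := rename_vand (n := n) σ
  rw [← parVand_mul n l, map_mul, rename_crossProd hσ] at h
  rw [h, mul_assoc]

/-- A permutation outside the parabolic subgroup kills the kernel. -/
lemma prod_cross_eq_zero {n l : ℕ} {σ : Equiv.Perm (Fin n)} (hσ : σ ∉ parabolicSubgroup n l) :
    ∏ p ∈ cross n l, (X (σ p.2) - X p.1 : MvPolynomial (Fin n) ℂ) = 0 := by
  have : ∃ j : Fin n, ¬ (j : ℕ) < l ∧ (σ j : ℕ) < l := by
    by_contra hcon
    push Not at hcon
    apply hσ
    have himp : ∀ j : Fin n, (σ j : ℕ) < l → (j : ℕ) < l := by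
      intro j hj
      by_contra h
      have := hcon j (not_lt.1 h)
      omega
    -- finite injectivity
    have hcard : (univ.filter (fun j : Fin n => (σ j : ℕ) < l)).card =
        (univ.filter (fun j : Fin n => (j : ℕ) < l)).card := by
      apply Finset.card_equiv σ
      intro i
      simp
    have hsub : (univ.filter (fun j : Fin n => (σ j : ℕ) < l)) ⊆
        (univ.filter (fun j : Fin n => (j : ℕ) < l)) := by
      intro j
      simpa using himp j
    have heq := Finset.eq_of_subset_of_card_le hsub hcard.ge
    intro j
    have := Finset.ext_iff.1 heq j
    simpa using this
  obtain ⟨j, hj, hj'⟩ := this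
  apply Finset.prod_eq_zero (i := (σ j, j))
  · simp only [cross, mem_filter, mem_univ, true_and]
    exact ⟨hj', hj⟩
  · simp

noncomputable instance instFintypePar (n l : ℕ) : Fintype (parabolicSubgroup n l) :=
  Fintype.ofFinite _

/-- Reynolds operator. -/
noncomputable def reyn (n l : ℕ) (f : MvPolynomial (Fin n) ℂ) : MvPolynomial (Fin n) ℂ :=
  ∑ π : parabolicSubgroup n l, rename (π : Equiv.Perm (Fin n)) f

lemma reyn_mem (n l : ℕ) (f : MvPolynomial (Fin n) ℂ) :
    reyn n l f ∈ invariantSubalgebra n (parabolicSubgroup n l) := by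
  intro σ hσ
  rw [reyn, map_sum]
  refine Fintype.sum_equiv (Equiv.mulLeft ⟨σ, hσ⟩) _ _ (fun τ => ?_)
  simp only [Equiv.coe_mulLeft, Subgroup.coe_mul]
  rw [rename_mul_perm]

lemma exists_kernel (n l : ℕ) : ∃ (S : Finset (MvPolynomial (Fin n) ℂ × MvPolynomial (Fin n) ℂ)),
    ∀ π σ : Equiv.Perm (Fin n), ∑ i ∈ S, rename π i.1 * rename σ i.2 =
      ∏ p ∈ cross n l, (X (σ p.2) - X (π p.1)) := by
  obtain ⟨S, hS⟩ := TensorProduct.exists_finset (R := ℂ)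
    (∏ p ∈ cross n l, ((1 : MvPolynomial (Fin n) ℂ) ⊗ₜ[ℂ] (X p.2 : MvPolynomial (Fin n) ℂ)
      - (X p.1) ⊗ₜ[ℂ] 1))
  refine ⟨S, fun π σ => ?_⟩
  have := congrArg (Algebra.TensorProduct.lift (rename π) (rename σ) (fun _ _ => Commute.all _ _) :
    MvPolynomial (Fin n) ℂ ⊗[ℂ] MvPolynomial (Fin n) ℂ →ₐ[ℂ] MvPolynomial (Fin n) ℂ) hS
  simp only [map_prod, map_sum, map_sub, Algebra.TensorProduct.lift_tmul, map_one, one_mul,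
    mul_one, rename_X] at this
  exact this.symm

lemma mem_par_iff {n l : ℕ} (σ : Equiv.Perm (Fin n)) :
    σ ∈ parabolicSubgroup n l ↔ ∀ i : Fin n, (σ i : ℕ) < l ↔ (i : ℕ) < l := Iff.rfl

lemma card_par (n l : ℕ) (hl : l ≤ n) :
    Fintype.card (parabolicSubgroup n l) = l.factorial * (n - l).factorial := by
  have h := DomMulAct.stabilizer_card (fun i : Fin n => decide ((i : ℕ) < l))
  have h1 : Fintype.card (parabolicSubgroup n l) =
    Fintype.card {g : Equiv.Perm (Fin n) //
      (fun i : Fin n => decide ((i : ℕ) < l)) ∘ g = (fun i : Fin n => decide ((i : ℕ) < l))} := by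
    apply Fintype.card_congr
    apply Equiv.subtypeEquivRight
    intro σ
    rw [mem_par_iff, funext_iff]
    simp
  have h2 : Fintype.card {a : Fin n // (a : ℕ) < l} = l := by
    rw [Fintype.card_subtype]
    have := Fin.card_filter_val_lt (n := n) (m := l)
    simp_all
  have h3 : Fintype.card {a : Fin n // l ≤ (a : ℕ)} = n - l := by
    have := Fintype.card_subtype_compl (fun a : Fin n => (a : ℕ) < l)
    simp only [not_lt, Fintype.card_fin, h2] at this
    convert this
  rw [h1, h, Fintype.prod_bool]
  simp [h2, h3]

lemma main_poly (n l : ℕ) (hl : l ≤ n) :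
    ∃ (ι : Type) (_ : Fintype ι) (u v : ι → MvPolynomial (Fin n) ℂ)
      (E : MvPolynomial (Fin n) ℂ →ₗ[ℂ] MvPolynomial (Fin n) ℂ),
      (∀ i, u i ∈ invariantSubalgebra n (parabolicSubgroup n l)) ∧
      (∀ i, v i ∈ invariantSubalgebra n (parabolicSubgroup n l)) ∧
      (∀ f, (E f).IsSymmetric) ∧ (∀ r f, r.IsSymmetric → E (r * f) = r * E f) ∧
      (∀ f ∈ invariantSubalgebra n (parabolicSubgroup n l), ∑ i, u i * E (v i * f) = f) ∧
      ∑ i, E (v i * u i) = C (n.choose l : ℂ) := by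
  classical
  obtain ⟨D, hD, hsym, hlin⟩ := exists_div n
  obtain ⟨S, hS⟩ := exists_kernel n l
  set N : ℂ := (Fintype.card (parabolicSubgroup n l) : ℂ) with hN
  have hN0 : N ≠ 0 := by
    rw [hN]; exact_mod_cast Fintype.card_ne_zero
  -- after applying Reynolds on both sides
  have hR : ∀ σ : Equiv.Perm (Fin n), ∑ i ∈ S, reyn n l i.1 * rename σ (reyn n l i.2) =
      C (N ^ 2) * ∏ p ∈ cross n l, (X (σ p.2) - X p.1) := by
    intro σ
    have : ∀ π τ : parabolicSubgroup n l,
        ∑ i ∈ S, rename (π : Equiv.Perm (Fin n)) i.1 *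
          rename (σ * τ : Equiv.Perm (Fin n)) i.2 =
        ∏ p ∈ cross n l, (X (σ p.2) - X p.1) := by
      intro π τ
      rw [hS]
      exact prod_cross_perm (fun i j => (X (σ j) - X i : MvPolynomial (Fin n) ℂ)) π.2 τ.2
    calc ∑ i ∈ S, reyn n l i.1 * rename σ (reyn n l i.2)
        = ∑ π : parabolicSubgroup n l, ∑ τ : parabolicSubgroup n l,
          ∑ i ∈ S, rename (π : Equiv.Perm (Fin n)) i.1 *
          rename (σ * τ : Equiv.Perm (Fin n)) i.2 := by
          simp only [reyn, map_sum, Finset.sum_mul_sum, rename_mul_perm]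
          rw [Finset.sum_comm]
          refine Finset.sum_congr rfl fun π _ => ?_
          rw [Finset.sum_comm]
      _ = _ := by
          simp only [this, Finset.sum_const, Finset.card_univ, hN, nsmul_eq_mul]
          simp only [map_pow, map_natCast]
          ring
  let E : MvPolynomial (Fin n) ℂ →ₗ[ℂ] MvPolynomial (Fin n) ℂ :=
    (N⁻¹) ^ 3 • (D.comp (LinearMap.mulLeft ℂ (parVand n l)))
  have hE : ∀ f, E f = C (N⁻¹ ^ 3) * D (parVand n l * f) := by
    intro f
    simp only [E, LinearMap.smul_apply, LinearMap.comp_apply, LinearMap.mulLeft_apply, C_mul']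
  have hv := vand_ne_zero n
  have hEv : ∀ f, vand n * E f = C (N⁻¹ ^ 3) * alt (parVand n l * f) := by
    intro f
    rw [hE, mul_left_comm, hD]
  refine ⟨S, inferInstance, fun i => reyn n l i.1.1, fun i => reyn n l i.1.2, E,
    fun i => reyn_mem _ _ _, fun i => reyn_mem _ _ _, ?_, ?_, ?_, ?_⟩
  · intro f
    rw [hE]
    exact (IsSymmetric.C _).mul (hsym _)
  · intro r f hr
    rw [hE, hE, mul_left_comm, hlin _ _ hr, mul_left_comm]
  · intro f hf
    apply mul_left_cancel₀ hv
    rw [Finset.sum_coe_sort S (fun i => reyn n l i.1 * E (reyn n l i.2 * f)), Finset.mul_sum]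
    simp only [mul_left_comm (vand n), hEv]
    have step : ∀ σ : Equiv.Perm (Fin n),
        ∑ i ∈ S, reyn n l i.1 * (C (N⁻¹ ^ 3) * (sg σ * rename σ (parVand n l * (reyn n l i.2 * f))))
        = if σ ∈ parabolicSubgroup n l then C (N⁻¹) * (vand n * f) else 0 := by
      intro σ
      have e1 : ∑ i ∈ S, reyn n l i.1 *
          (C (N⁻¹ ^ 3) * (sg σ * rename σ (parVand n l * (reyn n l i.2 * f)))) =
          (C (N⁻¹ ^ 3) * (sg σ * (rename σ (parVand n l) * rename σ f))) *
          ∑ i ∈ S, reyn n l i.1 * rename σ (reyn n l i.2) := by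
        rw [Finset.mul_sum]
        refine Finset.sum_congr rfl fun i _ => ?_
        rw [map_mul (rename σ), map_mul (rename σ)]
        generalize rename σ (parVand n l) = a1
        generalize rename σ (reyn n l i.2) = a2
        generalize rename σ f = a3
        generalize reyn n l i.1 = a4
        generalize sg σ = a5
        generalize (C (N⁻¹ ^ 3) : MvPolynomial (Fin n) ℂ) = a6
        ring
      rw [e1, hR]
      split_ifs with hσ
      · have e2 : ∏ p ∈ cross n l, (X (σ p.2) - X p.1 : MvPolynomial (Fin n) ℂ) = crossProd n l :=
          prod_cross_one hσ
        rw [e2, rename_parVand hσ, hf σ hσ, ← parVand_mul n l]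
        have e3 : (C (N⁻¹ ^ 3) * C (N ^ 2) : MvPolynomial (Fin n) ℂ) = C N⁻¹ := by
          rw [← C_mul]; congr 1; field_simp
        have e4 := sg_mul_self σ
        generalize (C (N⁻¹ ^ 3) : MvPolynomial (Fin n) ℂ) = a6 at *
        generalize (C (N ^ 2) : MvPolynomial (Fin n) ℂ) = a7 at *
        generalize (C (N⁻¹) : MvPolynomial (Fin n) ℂ) = a8 at *
        generalize sg σ = a5 at *
        linear_combination (a5 * a5 * parVand n l * crossProd n l * f) * e3 +
          (a8 * parVand n l * crossProd n l * f) * e4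
      · rw [prod_cross_eq_zero hσ]; simp
    simp only [alt, Finset.mul_sum]
    rw [Finset.sum_comm]
    simp only [step]
    rw [← Finset.sum_filter, Finset.sum_const, nsmul_eq_mul]
    have hc : (univ.filter (fun σ => σ ∈ parabolicSubgroup n l)).card =
      Fintype.card (parabolicSubgroup n l) := by
        rw [← Fintype.card_subtype]
    rw [hc, ← mul_assoc, ← map_natCast (C : ℂ →+* MvPolynomial (Fin n) ℂ), ← C_mul, ← hN,
      mul_inv_cancel₀ hN0, C_1, one_mul]
  · apply mul_left_cancel₀ hv
    rw [Finset.sum_coe_sort S (fun i => E (reyn n l i.2 * reyn n l i.1)), ← map_sum]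
    have h1 : ∑ i ∈ S, reyn n l i.2 * reyn n l i.1 = C (N ^ 2) * crossProd n l := by
      have := hR 1
      simp only [Equiv.Perm.coe_one, rename_id, AlgHom.id_apply, id] at this
      rw [crossProd, ← this]
      exact Finset.sum_congr rfl fun i _ => mul_comm _ _
    rw [h1, hEv]
    have h2 : parVand n l * (C (N ^ 2) * crossProd n l) = C (N ^ 2) * vand n := by
      rw [← parVand_mul n l]; ring
    rw [h2]
    have h3 : alt (C (N ^ 2) * vand n) = C (N ^ 2 * n.factorial) * vand n := by
      have : ∀ σ : Equiv.Perm (Fin n), sg σ * rename σ (C (N ^ 2) * vand n) =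
          C (N ^ 2) * vand n := by
        intro σ
        rw [map_mul, rename_C, rename_vand]
        linear_combination (C (N ^ 2) * vand n) * sg_mul_self σ
      simp only [alt, this, Finset.sum_const, Finset.card_univ, Fintype.card_perm,
        Fintype.card_fin, nsmul_eq_mul]
      rw [C_mul, map_natCast]; ring
    rw [h3, ← mul_assoc, ← C_mul, mul_comm (vand n)]
    congr 2
    have h4 : (n.choose l : ℂ) * N = n.factorial := by
      rw [hN, card_par n l hl]
      have := Nat.choose_mul_factorial_mul_factorial hl
      rw [← this]; push_cast; ring
    rw [← h4]
    field_simp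

end aux2
lemma frob_abstract (B : Type*) [CommRing B] [Algebra ℂ B] (ι : Type) [Fintype ι]
    (u v : ι → B) (φ : B →ₗ[ℂ] ℂ) (N : ℕ) (h : ∀ b, ∑ i, φ (v i * b) • u i = b)
    (ht : ∑ i, φ (v i * u i) = N) :
    Module.finrank ℂ B = N ∧ ∃ Φ : LinearMap.BilinForm ℂ B,
      (∀ a b, Φ a b = Φ b a) ∧ (∀ a b c, Φ (a * b) c = Φ a (b * c)) ∧ Φ.Nondegenerate := by
  classical
  constructor
  · have hfin : Module.Finite ℂ B := by
      refine ⟨⟨Finset.univ.image u, ?_⟩⟩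
      rw [eq_top_iff]
      intro b _
      rw [← h b]
      exact Submodule.sum_mem _ fun i _ => Submodule.smul_mem _ _
        (Submodule.subset_span (by simp))
    have hid : (LinearMap.id : B →ₗ[ℂ] B) =
        ∑ i, (φ.comp (LinearMap.mulLeft ℂ (v i))).smulRight (u i) := by
      ext b
      simp [h b]
    have h1 := LinearMap.trace_id ℂ B
    rw [hid, map_sum] at h1
    simp only [LinearMap.trace_smulRight, LinearMap.comp_apply, LinearMap.mulLeft_apply, ht] at h1
    exact_mod_cast h1.symm
  · refine ⟨(LinearMap.mul ℂ B).compr₂ φ, ?_, ?_, ?_⟩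
    · intro a b; simp [mul_comm]
    · intro a b c; simp [mul_assoc]
    · have key : ∀ a : B, (∀ b, φ (b * a) = 0) → a = 0 := by
        intro a ha
        rw [← h a]
        simp [ha]
      constructor
      · intro a ha
        apply key
        intro b
        rw [mul_comm]
        exact ha b
      · intro a ha
        exact key a ha

/-- For any `ε₁,...,ε_{k−1} ∈ ℂ`, the quotient algebra
`ℂ[w₁,...,w_{k−1}]^{S_l × S_{k−1−l}} / ⟨σ₁(w) − ε₁, ..., σ_{k−1}(w) − ε_{k−1}⟩`
has dimension `binomial(k−1, l)` over `ℂ` and is a Frobenius algebra (it carries a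
nondegenerate symmetric invariant bilinear form). -/
theorem invariant_quotient_dim_and_frobenius
    (k l : ℕ) (hl : l ≤ k - 1) (ε : Fin (k - 1) → ℂ) :
    Module.finrank ℂ
        (invariantSubalgebra (k - 1) (parabolicSubgroup (k - 1) l) ⧸
          Ideal.span (Set.range (sigmaMinusEps k l ε))) =
      Nat.choose (k - 1) l ∧
    ∃ Φ : LinearMap.BilinForm ℂ
        (invariantSubalgebra (k - 1) (parabolicSubgroup (k - 1) l) ⧸
          Ideal.span (Set.range (sigmaMinusEps k l ε))),
      (∀ a b, Φ a b = Φ b a) ∧ (∀ a b c, Φ (a * b) c = Φ a (b * c)) ∧ Φ.Nondegenerate := by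
  obtain ⟨ι, _, u, v, E, hu, hv, hEs, hEl, hE, hT⟩ := main_poly (k - 1) l hl
  set A := invariantSubalgebra (k - 1) (parabolicSubgroup (k - 1) l) with hA
  set I := Ideal.span (Set.range (sigmaMinusEps k l ε)) with hI
  let e := esymmAlgEquiv (Fin (k - 1)) ℂ (n := k - 1) (Fintype.card_fin _)
  let ev : symmetricSubalgebra (Fin (k - 1)) ℂ →ₐ[ℂ] ℂ := (aeval ε).comp e.symm.toAlgHom
  have hev : ∀ i : Fin (k - 1), ev ⟨esymm (Fin (k - 1)) ℂ (i + 1), esymm_isSymmetric _ _ _⟩ = ε i := by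
    intro i
    have : e (X i) = ⟨esymm (Fin (k - 1)) ℂ (i + 1), esymm_isSymmetric _ _ _⟩ := by
      simp [e, esymmAlgEquiv, esymmAlgHom]
    rw [← this]
    simp [ev]
  -- symmetric polynomials become constants in the quotient
  have hincl : ∀ r : symmetricSubalgebra (Fin (k - 1)) ℂ, (r : MvPolynomial (Fin (k - 1)) ℂ) ∈ A :=
    fun r σ _ => r.2 σ
  let inc : symmetricSubalgebra (Fin (k - 1)) ℂ →ₐ[ℂ] A := Subalgebra.inclusion
    (S := symmetricSubalgebra (Fin (k - 1)) ℂ) (T := A) (fun r hr => hincl ⟨r, hr⟩)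
  have hq : ∀ r, Ideal.Quotient.mkₐ ℂ I (inc r) = algebraMap ℂ (A ⧸ I) (ev r) := by
    have : ((Ideal.Quotient.mkₐ ℂ I).comp inc).comp e.toAlgHom =
        ((Algebra.ofId ℂ (A ⧸ I)).comp ev).comp e.toAlgHom := by
      apply MvPolynomial.algHom_ext
      intro i
      have hei : e (X i) = ⟨esymm (Fin (k - 1)) ℂ (i + 1), esymm_isSymmetric _ _ _⟩ := by
        simp [e, esymmAlgEquiv, esymmAlgHom]
      have hmem : sigmaMinusEps k l ε i ∈ I := Ideal.subset_span ⟨i, rfl⟩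
      rw [← Ideal.Quotient.eq_zero_iff_mem] at hmem
      have hsub : sigmaMinusEps k l ε i = inc (e (X i)) - algebraMap ℂ A (ε i) := by
        rw [hei]; rfl
      rw [hsub, map_sub, sub_eq_zero] at hmem
      change Ideal.Quotient.mk I (inc (e (X i))) = algebraMap ℂ (A ⧸ I) (ev (e (X i)))
      rw [hmem, hei, hev]
      rfl
    intro r
    have := DFunLike.congr_fun this (e.symm r)
    simpa using this
  let EA : A →ₗ[ℂ] symmetricSubalgebra (Fin (k - 1)) ℂ :=
    (E.comp A.val.toLinearMap).codRestrict
      (Subalgebra.toSubmodule (symmetricSubalgebra (Fin (k - 1)) ℂ)) (fun f => hEs f)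
  have hEA : ∀ f : A, ((EA f : symmetricSubalgebra (Fin (k - 1)) ℂ) : MvPolynomial (Fin (k - 1)) ℂ) = E f :=
    fun f => rfl
  have hEAl : ∀ r f, EA (inc r * f) = r * EA f := by
    intro r f
    apply Subtype.ext
    rw [hEA]
    exact hEl r.1 f.1 r.2
  let ψ : A →ₗ[ℂ] ℂ := ev.toLinearMap.comp EA
  have hψ : (I.restrictScalars ℂ) ≤ LinearMap.ker ψ := by
    intro a ha
    have ha' : a ∈ I := ha
    rw [LinearMap.mem_ker]
    rw [hI] at ha'
    refine Submodule.span_induction (p := fun a _ => ∀ b, ψ (b * a) = 0) ?_ ?_ ?_ ?_ ha' 1 |> fun h => by simpa using h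
    · rintro _ ⟨i, rfl⟩ b
      have hsub : sigmaMinusEps k l ε i = inc (⟨esymm (Fin (k - 1)) ℂ (i + 1), esymm_isSymmetric _ _ _⟩ - algebraMap ℂ _ (ε i)) := rfl
      rw [hsub, mul_comm]
      change ev (EA _) = 0
      rw [hEAl, map_mul, map_sub, hev, AlgHom.commutes]
      simp
    · intro b; simp
    · intro x y _ _ hx hy b
      rw [mul_add, map_add, hx, hy, add_zero]
    · intro c x _ hx b
      rw [smul_eq_mul, ← mul_assoc]
      exact hx _
  let φ : (A ⧸ I) →ₗ[ℂ] ℂ := Submodule.liftQ (I.restrictScalars ℂ) ψ hψ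
  have hφ : ∀ a : A, φ (Ideal.Quotient.mk I a) = ev (EA a) := fun a => rfl
  refine frob_abstract (A ⧸ I) ι (fun i => Ideal.Quotient.mk I ⟨u i, hu i⟩)
    (fun i => Ideal.Quotient.mk I ⟨v i, hv i⟩) φ _ ?_ ?_
  · intro b
    obtain ⟨f, rfl⟩ := Ideal.Quotient.mk_surjective b
    have h1 : ∑ i, (⟨u i, hu i⟩ : A) * inc (EA (⟨v i, hv i⟩ * f)) = f := by
      apply Subtype.ext
      rw [AddSubmonoidClass.coe_finsetSum]
      exact hE f.1 f.2
    conv_rhs => rw [← h1]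
    rw [map_sum]
    refine Finset.sum_congr rfl fun i _ => ?_
    rw [← map_mul (Ideal.Quotient.mk I), hφ, map_mul (Ideal.Quotient.mk I), Algebra.smul_def,
      ← hq]
    exact mul_comm (Ideal.Quotient.mk I (inc _)) _
  · have h1 : ∑ i, EA (⟨v i, hv i⟩ * ⟨u i, hu i⟩) = algebraMap ℂ _ ((k - 1).choose l : ℂ) := by
      apply Subtype.ext
      rw [AddSubmonoidClass.coe_finsetSum]
      exact hT
    have h2 := congrArg ev h1
    rw [map_sum, AlgHom.commutes] at h2
    exact h2
end
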